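/- arXiv:2203.02971 — 5 statements merged into one kernel-verified Lean document; each statement's English description precedes it below -/
import Mathlib

section
/- Let Γ be a finite simple graph that is a generalized circular ladder with at least one rung or a generalized Möbius ladder with at least two rungs, and let e be a rung of Γ. Then Γ admits a nowhere-zero 3-flow if and only if the graph Γ − e obtained by deleting the edge e does not admit a nowhere-zero 3-flow. -/
/-- A nowhere-zero 3-flow on a finite simple graph. -/
def HasNowhereZero3Flow {V : Type*} [Fintype V] (G : SimpleGraph V) : Prop :=
  ∃ f : V → V → ℤ,
    (∀ u v, f u v = - f v u) ∧
    (∀ u v, ¬ G.Adj u v → f u v = 0) ∧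
    (∀ u v, G.Adj u v → 0 < |f u v| ∧ |f u v| < 3) ∧
    ∀ u, ∑ v, f u v = 0

/-- Canonical model of a generalized circular ladder with `n` rungs: two disjoint
cycles `ZMod m₀` and `ZMod m₁` together with `n` rungs joining the attachment point
`A k` on the first cycle to the attachment point `B k` on the second one. -/
def genCircularModel (n m₀ m₁ : ℕ) (A B : Fin n → ℕ) :
    SimpleGraph (ZMod m₀ ⊕ ZMod m₁) :=
  SimpleGraph.fromRel (fun p q =>
    match p, q with
    | Sum.inl i, Sum.inl j => j = i + 1
    | Sum.inr i, Sum.inr j => j = i + 1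
    | Sum.inl i, Sum.inr j => ∃ k : Fin n, i = ((A k : ℕ) : ZMod m₀) ∧ j = ((B k : ℕ) : ZMod m₁)
    | Sum.inr _, Sum.inl _ => False)

/-- `Γ` is a generalized circular ladder with rung set `R`: there is an embedding of a
canonical model (two cycles of lengths `m₀, m₁ ≥ 3` with `n` rungs attached at strictly
increasing positions `A`, `B` in matching cyclic order) onto the edges of `Γ`, carrying
the model rungs exactly onto `R`.  The cases `n = 0` and `n = 1` are the disjoint union
of two cycles and two cycles joined by one edge, respectively. -/
def IsGenCircularLadder {V : Type*} (Γ : SimpleGraph V) (R : Set (Sym2 V)) : Prop :=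
  ∃ (n m₀ m₁ : ℕ) (A B : Fin n → ℕ) (ψ : (ZMod m₀ ⊕ ZMod m₁) ↪ V),
    3 ≤ m₀ ∧ 3 ≤ m₁ ∧
    StrictMono A ∧ StrictMono B ∧ (∀ k, A k < m₀) ∧ (∀ k, B k < m₁) ∧
    (∀ x y, Γ.Adj (ψ x) (ψ y) ↔ (genCircularModel n m₀ m₁ A B).Adj x y) ∧
    (∀ u w, Γ.Adj u w → ∃ x y, u = ψ x ∧ w = ψ y) ∧
    R = {e : Sym2 V | ∃ k : Fin n,
      e = s(ψ (Sum.inl ((A k : ℕ) : ZMod m₀)), ψ (Sum.inr ((B k : ℕ) : ZMod m₁)))}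

/-- Canonical model of a generalized Möbius ladder with `n` rungs: one cycle `ZMod m`
with `2n` attachment points `A 0 < ⋯ < A (n-1) < B 0 < ⋯ < B (n-1)` and `n` rungs
joining `A k` to `B k`. -/
def genMobiusModel (n m : ℕ) (A B : Fin n → ℕ) : SimpleGraph (ZMod m) :=
  SimpleGraph.fromRel (fun i j =>
    j = i + 1 ∨ ∃ k : Fin n, i = ((A k : ℕ) : ZMod m) ∧ j = ((B k : ℕ) : ZMod m))

/-- `Γ` is a generalized Möbius ladder with rung set `R`: there is an embedding of a
canonical model (a cycle of length `m ≥ 3` with rungs joining `A k` to `B k`, the `2n`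
attachment points being in the cyclic order `A 0, …, A (n-1), B 0, …, B (n-1)`, and each
rung joining points at cyclic distance at least two) onto the edges of `Γ`, carrying the
model rungs exactly onto `R`.  The cases `n = 0` and `n = 1` are a cycle and a cycle
with a chord, respectively. -/
def IsGenMobiusLadder {V : Type*} (Γ : SimpleGraph V) (R : Set (Sym2 V)) : Prop :=
  ∃ (n m : ℕ) (A B : Fin n → ℕ) (ψ : ZMod m ↪ V),
    3 ≤ m ∧ StrictMono A ∧ StrictMono B ∧
    (∀ k l, A k < B l) ∧ (∀ k, B k < m) ∧
    (∀ k, A k + 2 ≤ B k ∧ B k + 2 ≤ m + A k) ∧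
    (∀ x y, Γ.Adj (ψ x) (ψ y) ↔ (genMobiusModel n m A B).Adj x y) ∧
    (∀ u w, Γ.Adj u w → ∃ x y, u = ψ x ∧ w = ψ y) ∧
    R = {e : Sym2 V | ∃ k : Fin n,
      e = s(ψ ((A k : ℕ) : ZMod m), ψ ((B k : ℕ) : ZMod m))}

/-- A generalized closed ladder is a generalized circular or Möbius ladder. -/
def IsGenClosedLadder {V : Type*} (Γ : SimpleGraph V) (R : Set (Sym2 V)) : Prop :=
  IsGenCircularLadder Γ R ∨ IsGenMobiusLadder Γ R

section EdgeFlow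

variable {V E : Type*} [Fintype E]

open Classical in
/-- The antisymmetric function on pairs of vertices carrying the value `φ e` along each
edge `e` directed from `src e` to `tgt e`. -/
noncomputable def edgeFlow (src tgt : E → V) (φ : E → ℤ) (u v : V) : ℤ :=
  ∑ e, ((if src e = u ∧ tgt e = v then φ e else 0) - if tgt e = u ∧ src e = v then φ e else 0)

open Classical in
/-- The net outflow at the vertex `u` of an edge weighting `φ`. -/
noncomputable def edgeOutflow (src tgt : E → V) (φ : E → ℤ) (u : V) : ℤ :=
  ∑ e, ((if src e = u then φ e else 0) - if tgt e = u then φ e else 0)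

lemma edgeOutflow_eq [DecidableEq V] (src tgt : E → V) (φ : E → ℤ) (u : V) :
    edgeOutflow src tgt φ u =
      ∑ e, ((if src e = u then φ e else 0) - if tgt e = u then φ e else 0) := by
  unfold edgeOutflow
  congr!

lemma edgeFlow_antisymm (src tgt : E → V) (φ : E → ℤ) (u v : V) :
    edgeFlow src tgt φ u v = - edgeFlow src tgt φ v u := by
  unfold edgeFlow
  rw [← Finset.sum_neg_distrib]
  refine Finset.sum_congr rfl fun e _ => ?_
  classical
  rw [neg_sub]
  congr 1 <;> exact if_congr and_comm rfl rfl

lemma sum_edgeFlow [Fintype V] (src tgt : E → V) (φ : E → ℤ) (u : V) :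
    ∑ v, edgeFlow src tgt φ u v = edgeOutflow src tgt φ u := by
  unfold edgeFlow edgeOutflow
  classical
  rw [Finset.sum_comm]
  refine Finset.sum_congr rfl fun e _ => ?_
  rw [Finset.sum_sub_distrib]
  by_cases h₁ : src e = u <;> by_cases h₂ : tgt e = u <;> simp [h₁, h₂]

lemma edgeFlow_eq_zero {G : SimpleGraph V} {src tgt : E → V}
    (hadj : ∀ e, G.Adj (src e) (tgt e)) (φ : E → ℤ) {u v : V} (huv : ¬ G.Adj u v) :
    edgeFlow src tgt φ u v = 0 := by
  refine Finset.sum_eq_zero fun e _ => ?_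
  rw [if_neg, if_neg, sub_zero]
  · rintro ⟨rfl, rfl⟩
    exact huv (hadj e).symm
  · rintro ⟨rfl, rfl⟩
    exact huv (hadj e)

lemma edgeFlow_src_tgt {G : SimpleGraph V} {src tgt : E → V}
    (hinj : Function.Injective fun e => s(src e, tgt e))
    (hadj : ∀ e, G.Adj (src e) (tgt e)) (φ : E → ℤ) (e : E) :
    edgeFlow src tgt φ (src e) (tgt e) = φ e := by
  unfold edgeFlow
  rw [Finset.sum_eq_single e]
  · rw [if_pos ⟨rfl, rfl⟩, if_neg, sub_zero]
    rintro ⟨h, -⟩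
    exact (hadj e).ne h.symm
  · intro e' _ hne
    rw [if_neg, if_neg, sub_zero]
    · rintro ⟨h₁, h₂⟩
      exact hne (hinj (by simp [h₁, h₂]))
    · rintro ⟨h₁, h₂⟩
      exact hne (hinj (by simp [h₁, h₂]))
  · simp

/-- Nowhere-zero 3-flows in terms of weightings of the edges, listed without repetition. -/
lemma hasNowhereZero3Flow_iff_edgeOutflow [Fintype V] {G : SimpleGraph V} {src tgt : E → V}
    (hinj : Function.Injective fun e => s(src e, tgt e))
    (hrange : G.edgeSet = Set.range fun e => s(src e, tgt e)) :
    HasNowhereZero3Flow G ↔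
      ∃ φ : E → ℤ, (∀ e, 0 < |φ e| ∧ |φ e| < 3) ∧ ∀ u, edgeOutflow src tgt φ u = 0 := by
  have hadj (e : E) : G.Adj (src e) (tgt e) := by
    rw [← SimpleGraph.mem_edgeSet, hrange]
    exact ⟨e, rfl⟩
  have hex {u v : V} (h : G.Adj u v) :
      ∃ e, (src e = u ∧ tgt e = v) ∨ (src e = v ∧ tgt e = u) := by
    rw [← SimpleGraph.mem_edgeSet, hrange] at h
    obtain ⟨e, he⟩ := h
    exact ⟨e, Sym2.eq_iff.1 he⟩
  constructor
  · rintro ⟨f, hanti, hzero, hnz, hsum⟩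
    refine ⟨fun e => f (src e) (tgt e), fun e => hnz _ _ (hadj e), fun u => ?_⟩
    rw [← sum_edgeFlow, ← hsum u]
    refine Finset.sum_congr rfl fun v _ => ?_
    by_cases h : G.Adj u v
    · obtain ⟨e, ⟨rfl, rfl⟩ | ⟨rfl, rfl⟩⟩ := hex h
      · exact edgeFlow_src_tgt hinj hadj _ e
      · rw [edgeFlow_antisymm, edgeFlow_src_tgt hinj hadj, ← hanti]
    · rw [edgeFlow_eq_zero hadj _ h, hzero _ _ h]
  · rintro ⟨φ, hφ, hsum⟩
    refine ⟨edgeFlow src tgt φ, edgeFlow_antisymm src tgt φ,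
      fun u v h => edgeFlow_eq_zero hadj φ h, fun u v h => ?_, fun u => ?_⟩
    · obtain ⟨e, ⟨rfl, rfl⟩ | ⟨rfl, rfl⟩⟩ := hex h
      · rw [edgeFlow_src_tgt hinj hadj]
        exact hφ e
      · rw [edgeFlow_antisymm, edgeFlow_src_tgt hinj hadj, abs_neg]
        exact hφ e
    · rw [sum_edgeFlow, hsum]

lemma edgeOutflow_eq_zero_of_notMem_range {W : Type*} (ψ : W ↪ V) (src tgt : E → W)
    (φ : E → ℤ) {u : V} (hu : u ∉ Set.range ψ) :
    edgeOutflow (ψ ∘ src) (ψ ∘ tgt) φ u = 0 := by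
  refine Finset.sum_eq_zero fun e _ => ?_
  rw [if_neg, if_neg, sub_zero] <;> exact fun h => hu ⟨_, h⟩

lemma edgeOutflow_embedding {W : Type*} (ψ : W ↪ V) (src tgt : E → W) (φ : E → ℤ) (x : W) :
    edgeOutflow (ψ ∘ src) (ψ ∘ tgt) φ (ψ x) = edgeOutflow src tgt φ x := by
  classical
  refine Finset.sum_congr rfl fun e _ => ?_
  congr 1 <;> exact if_congr ψ.injective.eq_iff rfl rfl

lemma hasNowhereZero3Flow_iff_of_embedding [Fintype V] {W : Type*} {G : SimpleGraph V} (ψ : W ↪ V)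
    {src tgt : E → W} (hinj : Function.Injective fun e => s(src e, tgt e))
    (hrange : G.edgeSet = Set.range fun e => s(ψ (src e), ψ (tgt e))) :
    HasNowhereZero3Flow G ↔
      ∃ φ : E → ℤ, (∀ e, 0 < |φ e| ∧ |φ e| < 3) ∧ ∀ x, edgeOutflow src tgt φ x = 0 := by
  have hinj' : Function.Injective fun e => s((ψ ∘ src) e, (ψ ∘ tgt) e) :=
    (Sym2.map.injective ψ.injective).comp hinj
  rw [hasNowhereZero3Flow_iff_edgeOutflow hinj' hrange]
  refine exists_congr fun φ => and_congr_right fun _ => ⟨fun h x => ?_, fun h u => ?_⟩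
  · rw [← edgeOutflow_embedding ψ, h]
  · by_cases hu : u ∈ Set.range ψ
    · obtain ⟨x, rfl⟩ := hu
      rw [edgeOutflow_embedding, h]
    · exact edgeOutflow_eq_zero_of_notMem_range ψ src tgt φ hu

end EdgeFlow

section Cycle

variable {ι : Type*} [Fintype ι]

/-- The number of attachment points lying strictly before position `j`. -/
def countBelow (P : ι → ℕ) (j : ℕ) : ℕ := Fintype.card {p // P p < j}

lemma countBelow_zero (P : ι → ℕ) : countBelow P 0 = 0 := by
  simp [countBelow]

lemma countBelow_eq_card {P : ι → ℕ} {m : ℕ} (hP : ∀ p, P p < m) :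
    countBelow P m = Fintype.card ι := by
  simp [countBelow, hP]

lemma countBelow_succ_of_forall_ne {P : ι → ℕ} {j : ℕ} (h : ∀ p, P p ≠ j) :
    countBelow P (j + 1) = countBelow P j := by
  refine Fintype.card_congr (Equiv.subtypeEquivRight fun p => ?_)
  have := h p
  omega

lemma countBelow_succ {P : ι → ℕ} (hP : Function.Injective P) (p : ι) :
    countBelow P (P p + 1) = countBelow P (P p) + 1 := by
  classical
  simp only [countBelow, Fintype.card_subtype]
  rw [← Finset.card_insert_of_notMem (s := {q | P q < P p}) (a := p) (by simp)]
  congr 1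
  ext q
  simp only [Finset.mem_filter, Finset.mem_univ, true_and, Finset.mem_insert, ← hP.eq_iff]
  omega

/-- Conservation at every vertex of a cycle with rail weights `a`, where additional
edges with outward weights `σ` are attached at the positions `P`. -/
def IsCycleFlow {m : ℕ} (P : ι → ℕ) (a : ZMod m → ℤ) (σ : ι → ℤ) : Prop :=
  ∀ i, a i - a (i - 1) + ∑ p, (if ((P p : ℕ) : ZMod m) = i then σ p else 0) = 0

variable {m : ℕ} {P : ι → ℕ}

lemma natCast_inj_of_lt {a b : ℕ} (ha : a < m) (hb : b < m) :
    (a : ZMod m) = b ↔ a = b := by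
  rw [ZMod.natCast_eq_natCast_iff', Nat.mod_eq_of_lt ha, Nat.mod_eq_of_lt hb]

lemma sum_ite_of_forall_ne (hlt : ∀ p, P p < m) (σ : ι → ℤ) {j : ℕ} (hj : j < m)
    (h : ∀ p, P p ≠ j) : ∑ p, (if ((P p : ℕ) : ZMod m) = j then σ p else 0) = 0 :=
  Finset.sum_eq_zero fun p _ => if_neg fun hp => h p ((natCast_inj_of_lt (hlt p) hj).1 hp)

lemma sum_ite_apply (hP : Function.Injective P) (hlt : ∀ p, P p < m) (σ : ι → ℤ) (p : ι) :
    ∑ q, (if ((P q : ℕ) : ZMod m) = (P p : ℕ) then σ q else 0) = σ p := by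
  rw [Finset.sum_eq_single p]
  · simp
  · intro q _ hq
    exact if_neg fun h => hq (hP ((natCast_inj_of_lt (hlt q) (hlt p)).1 h))
  · simp

lemma zmod_three_eq_neg_of_sub_add_eq_zero :
    ∀ x y s : ZMod 3, x ≠ 0 → y ≠ 0 → s ≠ 0 → x - y + s = 0 → x = -y ∧ s = -y := by
  change ∀ x y s : Fin 3, x ≠ 0 → y ≠ 0 → s ≠ 0 → x - y + s = 0 → x = -y ∧ s = -y
  decide

lemma intCast_zmod_three_ne_zero {x : ℤ} (hx : 0 < |x| ∧ |x| < 3) : (x : ZMod 3) ≠ 0 := by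
  intro h
  rw [ZMod.intCast_zmod_eq_zero_iff_dvd] at h
  exact absurd (Int.le_of_dvd hx.1 ((dvd_abs _ _).2 h)) (by push_cast; omega)

lemma IsCycleFlow.intCast_eq {a : ZMod m → ℤ} {σ : ι → ℤ} (h : IsCycleFlow P a σ)
    (hP : Function.Injective P) (hlt : ∀ p, P p < m)
    (ha : ∀ i, (a i : ZMod 3) ≠ 0) (hσ : ∀ p, (σ p : ZMod 3) ≠ 0) {j : ℕ} (hj : j ≤ m) :
    (a (j - 1) : ZMod 3) = (-1) ^ countBelow P j * a (-1) := by
  induction j with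
  | zero => simp [countBelow_zero]
  | succ j ih =>
    have hj' : j < m := hj
    have hc := congrArg (Int.cast : ℤ → ZMod 3) (h j)
    rw [Nat.cast_succ, add_sub_cancel_right]
    by_cases hp : ∃ p, P p = j
    · obtain ⟨p, rfl⟩ := hp
      rw [sum_ite_apply hP hlt] at hc
      push_cast at hc
      rw [countBelow_succ hP, pow_succ, mul_neg_one, neg_mul, ← ih hj'.le]
      exact (zmod_three_eq_neg_of_sub_add_eq_zero _ _ _ (ha _) (ha _) (hσ p) hc).1
    · push Not at hp
      rw [sum_ite_of_forall_ne hlt σ hj' hp] at hc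
      push_cast at hc
      rw [countBelow_succ_of_forall_ne hp, ← ih hj'.le, ← sub_eq_zero]
      simpa using hc

lemma IsCycleFlow.intCast_attached_eq {a : ZMod m → ℤ} {σ : ι → ℤ} (h : IsCycleFlow P a σ)
    (hP : Function.Injective P) (hlt : ∀ p, P p < m)
    (ha : ∀ i, (a i : ZMod 3) ≠ 0) (hσ : ∀ p, (σ p : ZMod 3) ≠ 0) (p : ι) :
    (σ p : ZMod 3) = -((-1) ^ countBelow P (P p) * a (-1)) := by
  have hc := congrArg (Int.cast : ℤ → ZMod 3) (h (P p))
  rw [sum_ite_apply hP hlt] at hc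
  push_cast at hc
  rw [← h.intCast_eq hP hlt ha hσ (hlt p).le]
  exact (zmod_three_eq_neg_of_sub_add_eq_zero _ _ _ (ha _) (ha _) (hσ p) hc).2

lemma IsCycleFlow.even_card {a : ZMod m → ℤ} {σ : ι → ℤ} (h : IsCycleFlow P a σ)
    (hP : Function.Injective P) (hlt : ∀ p, P p < m)
    (ha : ∀ i, (a i : ZMod 3) ≠ 0) (hσ : ∀ p, (σ p : ZMod 3) ≠ 0) :
    Even (Fintype.card ι) := by
  have hm := h.intCast_eq hP hlt ha hσ le_rfl
  rw [countBelow_eq_card hlt, ZMod.natCast_self, zero_sub] at hm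
  by_contra hodd
  rw [(Nat.not_even_iff_odd.1 hodd).neg_one_pow] at hm
  have key : ∀ x : ZMod 3, x = -1 * x → x = 0 := by decide
  exact ha _ (key _ hm)

/-- Rail weights alternating between `1` and `2` at the attachment points `P`. -/
def alternatingRail (m : ℕ) (P : ι → ℕ) (i : ZMod m) : ℤ :=
  if Even (countBelow P (i.val + 1)) then 1 else 2

/-- The outward weights at the attachment points forced by `alternatingRail`. -/
def alternatingRung (P : ι → ℕ) (p : ι) : ℤ :=
  if Even (countBelow P (P p)) then -1 else 1

lemma alternatingRail_pred [NeZero m] (hlt : ∀ p, P p < m) (heven : Even (Fintype.card ι))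
    {j : ℕ} (hj : j < m) :
    alternatingRail m P ((j : ZMod m) - 1) = if Even (countBelow P j) then 1 else 2 := by
  cases j with
  | zero =>
    obtain ⟨n, rfl⟩ := Nat.exists_eq_succ_of_ne_zero (NeZero.ne m)
    simp [alternatingRail, countBelow_zero, ZMod.val_neg_one, countBelow_eq_card hlt, heven]
  | succ j =>
    rw [Nat.cast_succ, add_sub_cancel_right, alternatingRail, ZMod.val_cast_of_lt (by omega)]

lemma isCycleFlow_alternating [NeZero m] (hP : Function.Injective P) (hlt : ∀ p, P p < m)
    (heven : Even (Fintype.card ι)) :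
    IsCycleFlow P (alternatingRail m P) (alternatingRung P) := by
  intro i
  obtain ⟨j, hj, rfl⟩ : ∃ j < m, (j : ZMod m) = i :=
    ⟨i.val, i.val_lt, ZMod.natCast_rightInverse i⟩
  rw [alternatingRail_pred hlt heven hj, alternatingRail, ZMod.val_cast_of_lt hj]
  by_cases hp : ∃ p, P p = j
  · obtain ⟨p, rfl⟩ := hp
    rw [sum_ite_apply hP hlt, countBelow_succ hP, alternatingRung]
    by_cases h : Even (countBelow P (P p)) <;> simp [h, Nat.even_add_one]
  · push Not at hp
    rw [sum_ite_of_forall_ne hlt _ hj hp, countBelow_succ_of_forall_ne hp]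
    simp

lemma alternatingRail_bounds (P : ι → ℕ) (i : ZMod m) :
    1 ≤ alternatingRail m P i ∧ alternatingRail m P i ≤ 2 := by
  unfold alternatingRail
  split_ifs <;> norm_num

lemma abs_alternatingRung (P : ι → ℕ) (p : ι) : |alternatingRung P p| = 1 := by
  unfold alternatingRung
  split_ifs <;> norm_num

end Cycle

section Ladder

variable {K : Type*} {m m₀ m₁ : ℕ}

lemma natCast_injective_of_strictMono [LinearOrder K] {A : K → ℕ} (hA : StrictMono A)
    (hlt : ∀ k, A k < m) : Function.Injective fun k => (A k : ZMod m) :=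
  fun k l h => hA.injective ((natCast_inj_of_lt (hlt k) (hlt l)).1 h)

lemma ne_add_one_add_one (hm : 3 ≤ m) (i : ZMod m) : i + 1 + 1 ≠ i := by
  intro h
  have h2 : ((2 : ℕ) : ZMod m) = ((0 : ℕ) : ZMod m) := by
    push_cast
    linear_combination h
  exact absurd ((natCast_inj_of_lt (by omega) (by omega)).1 h2) (by norm_num)

/-- Tails of the edges of a circular ladder: two rails and the rungs. -/
def circularSrc (m₀ m₁ : ℕ) (A : K → ℕ) : ZMod m₀ ⊕ ZMod m₁ ⊕ K → ZMod m₀ ⊕ ZMod m₁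
  | .inl i => .inl i
  | .inr (.inl i) => .inr i
  | .inr (.inr k) => .inl (A k)

/-- Heads of the edges of a circular ladder: two rails and the rungs. -/
def circularTgt (m₀ m₁ : ℕ) (B : K → ℕ) : ZMod m₀ ⊕ ZMod m₁ ⊕ K → ZMod m₀ ⊕ ZMod m₁
  | .inl i => .inl (i + 1)
  | .inr (.inl i) => .inr (i + 1)
  | .inr (.inr k) => .inr (B k)

/-- Tails of the edges of a Möbius ladder: the rail and the rungs. -/
def mobiusSrc (m : ℕ) (A : K → ℕ) : ZMod m ⊕ K → ZMod m
  | .inl i => i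
  | .inr k => A k

/-- Heads of the edges of a Möbius ladder: the rail and the rungs. -/
def mobiusTgt (m : ℕ) (B : K → ℕ) : ZMod m ⊕ K → ZMod m
  | .inl i => i + 1
  | .inr k => B k

lemma circular_edge_injective [LinearOrder K] {A B : K → ℕ} (hm₀ : 3 ≤ m₀) (hm₁ : 3 ≤ m₁)
    (hA : StrictMono A) (hlt : ∀ k, A k < m₀) :
    Function.Injective fun e => s(circularSrc m₀ m₁ A e, circularTgt m₀ m₁ B e) := by
  have hinj := natCast_injective_of_strictMono hA hlt
  rintro (i | i | k) (j | j | l) h <;>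
    simp only [circularSrc, circularTgt, Sym2.eq_iff, Sum.inl.injEq, Sum.inr.injEq, reduceCtorEq,
      and_false, false_and, or_false] at h
  · rcases h with h | ⟨h, h'⟩
    · rw [h.1]
    · exact absurd (h ▸ h') (ne_add_one_add_one hm₀ j)
  · rcases h with h | ⟨h, h'⟩
    · rw [h.1]
    · exact absurd (h ▸ h') (ne_add_one_add_one hm₁ j)
  · rw [hinj h.1]

lemma natCast_eq_add_one_iff {a b : ℕ} (ha : a < m) (hb : b < m) :
    (b : ZMod m) = (a : ZMod m) + 1 ↔ b = a + 1 ∨ (b = 0 ∧ a + 1 = m) := by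
  rw [← Nat.cast_succ]
  rcases Nat.lt_or_ge (a + 1) m with h | h
  · rw [natCast_inj_of_lt hb h]
    omega
  · obtain rfl : m = a + 1 := by omega
    rw [ZMod.natCast_self, ZMod.natCast_eq_zero_iff]
    constructor
    · intro hd
      exact Or.inr ⟨Nat.eq_zero_of_dvd_of_lt hd hb, rfl⟩
    · rintro (h | ⟨rfl, -⟩)
      · omega
      · exact dvd_zero _

lemma mobius_edge_injective [LinearOrder K] {A B : K → ℕ} (hm : 3 ≤ m)
    (hA : StrictMono A) (hAB : ∀ k l, A k < B l) (hlt : ∀ k, B k < m)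
    (hdist : ∀ k, A k + 2 ≤ B k ∧ B k + 2 ≤ m + A k) :
    Function.Injective fun e => s(mobiusSrc m A e, mobiusTgt m B e) := by
  have hAlt (k : K) : A k < m := (hAB k k).trans (hlt k)
  have hinj := natCast_injective_of_strictMono hA hAlt
  have hrung (k : K) (i : ZMod m) : s(i, i + 1) ≠ s((A k : ZMod m), (B k : ZMod m)) := by
    have := hdist k
    intro h
    rcases Sym2.eq_iff.1 h with ⟨rfl, h⟩ | ⟨rfl, h⟩
    · rcases (natCast_eq_add_one_iff (hAlt k) (hlt k)).1 h.symm with h | h <;> omega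
    · rcases (natCast_eq_add_one_iff (hlt k) (hAlt k)).1 h.symm with h | h <;> omega
  rintro (i | k) (j | l) h
  · rcases Sym2.eq_iff.1 h with h | ⟨h, h'⟩
    · exact congrArg _ h.1
    · simp only [mobiusSrc, mobiusTgt] at h h'
      exact absurd (h ▸ h') (ne_add_one_add_one hm j)
  · exact absurd h (hrung l i)
  · exact absurd h.symm (hrung k j)
  · rcases Sym2.eq_iff.1 h with h | ⟨h, -⟩
    · exact congrArg _ (hinj h.1)
    · exact absurd ((natCast_inj_of_lt (hAlt k) (hlt l)).1 h) (hAB k l).ne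

variable [Fintype K]

lemma sum_ite_neg (p : K → Prop) [DecidablePred p] (r : K → ℤ) :
    ∑ k, (if p k then -r k else 0) = -∑ k, if p k then r k else 0 := by
  rw [← Finset.sum_neg_distrib]
  exact Finset.sum_congr rfl fun k _ => by split_ifs <;> simp

lemma circular_edgeOutflow_inl [NeZero m₀] [NeZero m₁] (A B : K → ℕ)
    (φ : ZMod m₀ ⊕ ZMod m₁ ⊕ K → ℤ) (i : ZMod m₀) :
    edgeOutflow (circularSrc m₀ m₁ A) (circularTgt m₀ m₁ B) φ (.inl i) =
      φ (.inl i) - φ (.inl (i - 1)) +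
        ∑ k, (if ((A k : ℕ) : ZMod m₀) = i then φ (.inr (.inr k)) else 0) := by
  classical
  simp [edgeOutflow, circularSrc, circularTgt, ← eq_sub_iff_add_eq]
  ring

lemma circular_edgeOutflow_inr [NeZero m₀] [NeZero m₁] (A B : K → ℕ)
    (φ : ZMod m₀ ⊕ ZMod m₁ ⊕ K → ℤ) (i : ZMod m₁) :
    edgeOutflow (circularSrc m₀ m₁ A) (circularTgt m₀ m₁ B) φ (.inr i) =
      φ (.inr (.inl i)) - φ (.inr (.inl (i - 1))) +
        ∑ k, (if ((B k : ℕ) : ZMod m₁) = i then -φ (.inr (.inr k)) else 0) := by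
  classical
  simp [edgeOutflow, circularSrc, circularTgt, ← eq_sub_iff_add_eq]
  rw [sum_ite_neg]
  ring

lemma mobius_edgeOutflow [NeZero m] (A B : K → ℕ) (φ : ZMod m ⊕ K → ℤ) (i : ZMod m) :
    edgeOutflow (mobiusSrc m A) (mobiusTgt m B) φ i =
      φ (.inl i) - φ (.inl (i - 1)) + ∑ p : K ⊕ K,
        (if ((Sum.elim A B p : ℕ) : ZMod m) = i then
          Sum.elim (fun k => φ (.inr k)) (fun k => -φ (.inr k)) p else 0) := by
  rw [edgeOutflow_eq, Fintype.sum_sum_type, Fintype.sum_sum_type]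
  change ∑ j, ((if j = i then φ (.inl j) else 0) - if j + 1 = i then φ (.inl j) else 0) +
      ∑ k, ((if (A k : ZMod m) = i then φ (.inr k) else 0) -
        if (B k : ZMod m) = i then φ (.inr k) else 0) =
    φ (.inl i) - φ (.inl (i - 1)) + (∑ k, (if (A k : ZMod m) = i then φ (.inr k) else 0) +
      ∑ k, if (B k : ZMod m) = i then -φ (.inr k) else 0)
  simp only [Finset.sum_sub_distrib, ← eq_sub_iff_add_eq, sum_ite_neg, Finset.sum_ite_eq',
    Finset.mem_univ, if_true]
  ring

lemma countBelow_strictMono [LinearOrder K] {A B : K → ℕ} (hA : StrictMono A) (hB : StrictMono B)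
    (k : K) : countBelow A (A k) = countBelow B (B k) :=
  Fintype.card_congr (Equiv.subtypeEquivRight fun l => by rw [hA.lt_iff_lt, hB.lt_iff_lt])

lemma countBelow_sumElim (A B : K → ℕ) (j : ℕ) :
    countBelow (Sum.elim A B) j = countBelow A j + countBelow B j := by
  classical
  simp only [countBelow]
  rw [← Fintype.card_sum]
  exact Fintype.card_congr Equiv.subtypeSum

/-- A circular ladder has a nowhere-zero 3-flow iff its number of rungs is even. -/
lemma circular_exists_edgeOutflow_iff [LinearOrder K] [NeZero m₀] [NeZero m₁] {A B : K → ℕ}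
    (hA : StrictMono A) (hB : StrictMono B) (hAlt : ∀ k, A k < m₀) (hBlt : ∀ k, B k < m₁) :
    (∃ φ : ZMod m₀ ⊕ ZMod m₁ ⊕ K → ℤ, (∀ e, 0 < |φ e| ∧ |φ e| < 3) ∧
      ∀ x, edgeOutflow (circularSrc m₀ m₁ A) (circularTgt m₀ m₁ B) φ x = 0) ↔
      Even (Fintype.card K) := by
  constructor
  · rintro ⟨φ, hφ, h⟩
    have hflow : IsCycleFlow A (fun i => φ (.inl i)) fun k => φ (.inr (.inr k)) :=
      fun i => (circular_edgeOutflow_inl A B φ i).symm.trans (h _)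
    exact hflow.even_card hA.injective hAlt (fun i => intCast_zmod_three_ne_zero (hφ _))
      fun k => intCast_zmod_three_ne_zero (hφ _)
  · intro heven
    refine ⟨Sum.elim (alternatingRail m₀ A)
      (Sum.elim (fun i => 3 - alternatingRail m₁ B i) (alternatingRung A)), ?_, ?_⟩
    · rintro (i | i | k)
      · have := alternatingRail_bounds A i
        simp only [Sum.elim_inl, abs_pos, abs_lt]
        omega
      · have := alternatingRail_bounds B i
        simp only [Sum.elim_inl, Sum.elim_inr, abs_pos, abs_lt]
        omega
      · simp [abs_alternatingRung]
    · rintro (i | i)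
      · rw [circular_edgeOutflow_inl]
        exact isCycleFlow_alternating hA.injective hAlt heven i
      · rw [circular_edgeOutflow_inr]
        have hr : alternatingRung A = alternatingRung B := by
          funext k
          rw [alternatingRung, alternatingRung, countBelow_strictMono hA hB]
        have := isCycleFlow_alternating hB.injective hBlt heven i
        simp only [Sum.elim_inl, Sum.elim_inr, hr, sum_ite_neg]
        linarith

/-- A Möbius ladder with at least one rung has a nowhere-zero 3-flow iff its number of
rungs is odd. -/
lemma mobius_exists_edgeOutflow_iff [LinearOrder K] [Nonempty K] [NeZero m] {A B : K → ℕ}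
    (hA : StrictMono A) (hB : StrictMono B) (hAB : ∀ k l, A k < B l) (hlt : ∀ k, B k < m) :
    (∃ φ : ZMod m ⊕ K → ℤ, (∀ e, 0 < |φ e| ∧ |φ e| < 3) ∧
      ∀ x, edgeOutflow (mobiusSrc m A) (mobiusTgt m B) φ x = 0) ↔
      Odd (Fintype.card K) := by
  have hinj : Function.Injective (Sum.elim A B) :=
    hA.injective.sumElim hB.injective fun k l => (hAB k l).ne
  have hltAB (p : K ⊕ K) : Sum.elim A B p < m := by
    rcases p with k | k
    · exact (hAB k k).trans (hlt k)
    · exact hlt k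
  have hcountA (k : K) : countBelow (Sum.elim A B) (A k) = countBelow A (A k) := by
    have : IsEmpty {l // B l < A k} := ⟨fun l => (hAB k l.1).not_gt l.2⟩
    have hzero : countBelow B (A k) = 0 := Fintype.card_eq_zero
    rw [countBelow_sumElim, hzero, add_zero]
  have hcountB (k : K) :
      countBelow (Sum.elim A B) (B k) = Fintype.card K + countBelow A (A k) := by
    rw [countBelow_sumElim, countBelow_eq_card (fun l => hAB l k), countBelow_strictMono hA hB]
  constructor
  · rintro ⟨φ, hφ, h⟩
    have hflow : IsCycleFlow (Sum.elim A B) (fun i => φ (.inl i))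
        (Sum.elim (fun k => φ (.inr k)) fun k => -φ (.inr k)) :=
      fun i => (mobius_edgeOutflow A B φ i).symm.trans (h _)
    have ha (i : ZMod m) : ((φ (.inl i) : ℤ) : ZMod 3) ≠ 0 := intCast_zmod_three_ne_zero (hφ _)
    have hσ (p : K ⊕ K) :
        ((Sum.elim (fun k => φ (.inr k)) (fun k => -φ (.inr k)) p : ℤ) : ZMod 3) ≠ 0 := by
      rcases p with k | k
      · exact intCast_zmod_three_ne_zero (hφ _)
      · exact intCast_zmod_three_ne_zero (by simpa using hφ (.inr k))
    obtain ⟨k⟩ := ‹Nonempty K›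
    have h₁ := hflow.intCast_attached_eq hinj hltAB ha hσ (.inl k)
    have h₂ := hflow.intCast_attached_eq hinj hltAB ha hσ (.inr k)
    simp only [Sum.elim_inl, Sum.elim_inr, hcountA, hcountB] at h₁ h₂
    by_contra hodd
    rw [pow_add, (Nat.not_odd_iff_even.1 hodd).neg_one_pow, one_mul, ← h₁, Int.cast_neg] at h₂
    have key : ∀ x : ZMod 3, -x = x → x = 0 := by decide
    exact hσ (.inl k) (key _ h₂)
  · intro hodd
    refine ⟨Sum.elim (alternatingRail m (Sum.elim A B))
      fun k => alternatingRung (Sum.elim A B) (.inl k), ?_, fun i => ?_⟩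
    · rintro (i | k)
      · have := alternatingRail_bounds (Sum.elim A B) i
        simp only [Sum.elim_inl, abs_pos, abs_lt]
        omega
      · simp [abs_alternatingRung]
    · have heven : Even (Fintype.card (K ⊕ K)) := by
        rw [Fintype.card_sum]
        exact ⟨_, rfl⟩
      rw [mobius_edgeOutflow]
      refine Eq.trans ?_ (isCycleFlow_alternating hinj hltAB heven i)
      refine congrArg _ (Finset.sum_congr rfl fun p _ => if_congr Iff.rfl ?_ rfl)
      rcases p with k | k
      · rfl
      · simp only [alternatingRung, Sum.elim_inl, Sum.elim_inr, hcountA, hcountB,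
          Nat.even_add, Nat.not_even_iff_odd.2 hodd, false_iff]
        split_ifs <;> simp_all

end Ladder

section DeleteRung

variable {V : Type*} {Γ : SimpleGraph V}

lemma card_subtype_ne_add_one {K : Type*} [Fintype K] [DecidableEq K] (k : K) :
    Fintype.card {l // l ≠ k} + 1 = Fintype.card K := by
  have := Fintype.card_pos_iff.2 ⟨k⟩
  rw [Fintype.card_subtype_compl (· = k), Fintype.card_subtype_eq]
  omega

lemma circular_edgeSet {n m₀ m₁ : ℕ} {A B : Fin n → ℕ} (hm₀ : 3 ≤ m₀) (hm₁ : 3 ≤ m₁)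
    {ψ : (ZMod m₀ ⊕ ZMod m₁) ↪ V}
    (hadj : ∀ x y, Γ.Adj (ψ x) (ψ y) ↔ (genCircularModel n m₀ m₁ A B).Adj x y)
    (hcover : ∀ u w, Γ.Adj u w → ∃ x y, u = ψ x ∧ w = ψ y) :
    Γ.edgeSet = Set.range fun e => s(ψ (circularSrc m₀ m₁ A e), ψ (circularTgt m₀ m₁ B e)) := by
  have : Fact (1 < m₀) := ⟨by omega⟩
  have : Fact (1 < m₁) := ⟨by omega⟩
  ext e
  induction e with | _ u w
  rw [SimpleGraph.mem_edgeSet]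
  constructor
  · intro h
    obtain ⟨x, y, rfl, rfl⟩ := hcover u w h
    obtain ⟨-, h⟩ := (hadj x y).1 h
    rcases x with i | i <;> rcases y with j | j
    · rcases h with rfl | rfl
      · exact ⟨.inl i, rfl⟩
      · exact ⟨.inl j, Sym2.eq_swap⟩
    · obtain ⟨k, rfl, rfl⟩ := h.resolve_right id
      exact ⟨.inr (.inr k), rfl⟩
    · obtain ⟨k, rfl, rfl⟩ := h.resolve_left id
      exact ⟨.inr (.inr k), Sym2.eq_swap⟩
    · rcases h with rfl | rfl
      · exact ⟨.inr (.inl i), rfl⟩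
      · exact ⟨.inr (.inl j), Sym2.eq_swap⟩
  · rintro ⟨e, he⟩
    rw [← SimpleGraph.mem_edgeSet, ← he, SimpleGraph.mem_edgeSet, hadj]
    rcases e with i | i | k
    · exact ⟨by simp [circularSrc, circularTgt], Or.inl rfl⟩
    · exact ⟨by simp [circularSrc, circularTgt], Or.inl rfl⟩
    · exact ⟨by simp [circularSrc, circularTgt], Or.inl ⟨k, rfl, rfl⟩⟩

lemma mobius_edgeSet {n m : ℕ} {A B : Fin n → ℕ} (hm : 3 ≤ m)
    (hAB : ∀ k l, A k < B l) (hlt : ∀ k, B k < m) {ψ : ZMod m ↪ V}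
    (hadj : ∀ x y, Γ.Adj (ψ x) (ψ y) ↔ (genMobiusModel n m A B).Adj x y)
    (hcover : ∀ u w, Γ.Adj u w → ∃ x y, u = ψ x ∧ w = ψ y) :
    Γ.edgeSet = Set.range fun e => s(ψ (mobiusSrc m A e), ψ (mobiusTgt m B e)) := by
  have : Fact (1 < m) := ⟨by omega⟩
  ext e
  induction e with | _ u w
  rw [SimpleGraph.mem_edgeSet]
  constructor
  · intro h
    obtain ⟨x, y, rfl, rfl⟩ := hcover u w h
    obtain ⟨-, (rfl | ⟨k, rfl, rfl⟩) | (rfl | ⟨k, rfl, rfl⟩)⟩ := (hadj x y).1 h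
    · exact ⟨.inl x, rfl⟩
    · exact ⟨.inr k, rfl⟩
    · exact ⟨.inl y, Sym2.eq_swap⟩
    · exact ⟨.inr k, Sym2.eq_swap⟩
  · rintro ⟨e, he⟩
    rw [← SimpleGraph.mem_edgeSet, ← he, SimpleGraph.mem_edgeSet, hadj]
    rcases e with i | k
    · exact ⟨by simp [mobiusSrc, mobiusTgt], Or.inl (Or.inl rfl)⟩
    · refine ⟨fun h => ?_, Or.inl (Or.inr ⟨k, rfl, rfl⟩)⟩
      exact (hAB k k).ne ((natCast_inj_of_lt ((hAB k k).trans (hlt k)) (hlt k)).1 h)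

lemma IsGenCircularLadder.delete_rung [Fintype V] {R : Set (Sym2 V)}
    (h : IsGenCircularLadder Γ R) {e : Sym2 V} (he : e ∈ R) :
    HasNowhereZero3Flow Γ ↔ ¬ HasNowhereZero3Flow (Γ.deleteEdges {e}) := by
  obtain ⟨n, m₀, m₁, A, B, ψ, hm₀, hm₁, hA, hB, hAlt, hBlt, hadj, hcover, rfl⟩ := h
  obtain ⟨k, rfl⟩ := he
  have : NeZero m₀ := ⟨by omega⟩
  have : NeZero m₁ := ⟨by omega⟩
  have hedge := circular_edgeSet hm₀ hm₁ hadj hcover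
  have hinj := circular_edge_injective (B := B) hm₀ hm₁ hA hAlt
  let A' : {l // l ≠ k} → ℕ := fun l => A l
  let B' : {l // l ≠ k} → ℕ := fun l => B l
  have hA' : StrictMono A' := fun _ _ h => hA h
  have hB' : StrictMono B' := fun _ _ h => hB h
  have hedge' : (Γ.deleteEdges {s(ψ (.inl (A k)), ψ (.inr (B k)))}).edgeSet =
      Set.range fun e => s(ψ (circularSrc m₀ m₁ A' e), ψ (circularTgt m₀ m₁ B' e)) := by
    have hinj' := (Sym2.map.injective ψ.injective).comp hinj
    rw [SimpleGraph.edgeSet_deleteEdges, hedge]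
    ext e
    constructor
    · rintro ⟨⟨i | i | l, rfl⟩, hne⟩
      · exact ⟨.inl i, rfl⟩
      · exact ⟨.inr (.inl i), rfl⟩
      · exact ⟨.inr (.inr ⟨l, fun h => hne (by rw [h]; rfl)⟩), rfl⟩
    · rintro ⟨i | i | l, rfl⟩
      · exact ⟨⟨.inl i, rfl⟩, fun h => by simpa using @hinj' (.inl i) (.inr (.inr k)) h⟩
      · exact ⟨⟨.inr (.inl i), rfl⟩, fun h =>
          by simpa using @hinj' (.inr (.inl i)) (.inr (.inr k)) h⟩
      · exact ⟨⟨.inr (.inr l), rfl⟩, fun h =>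
          l.2 (by simpa using @hinj' (.inr (.inr l)) (.inr (.inr k)) h)⟩
  rw [hasNowhereZero3Flow_iff_of_embedding ψ hinj hedge,
    circular_exists_edgeOutflow_iff hA hB hAlt hBlt,
    hasNowhereZero3Flow_iff_of_embedding ψ
      (circular_edge_injective hm₀ hm₁ hA' fun l => hAlt l) hedge',
    circular_exists_edgeOutflow_iff hA' hB' (fun l => hAlt l) fun l => hBlt l,
    ← card_subtype_ne_add_one k, Nat.even_add_one]

lemma IsGenMobiusLadder.delete_rung [Fintype V] {R : Set (Sym2 V)}
    (h : IsGenMobiusLadder Γ R) (hR : R.Nontrivial) {e : Sym2 V} (he : e ∈ R) :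
    HasNowhereZero3Flow Γ ↔ ¬ HasNowhereZero3Flow (Γ.deleteEdges {e}) := by
  obtain ⟨n, m, A, B, ψ, hm, hA, hB, hAB, hlt, hdist, hadj, hcover, rfl⟩ := h
  obtain ⟨_, ⟨l, rfl⟩, hne⟩ := hR.exists_ne e
  obtain ⟨k, rfl⟩ := he
  have : NeZero m := ⟨by omega⟩
  have : Nonempty (Fin n) := ⟨k⟩
  have : Nonempty {l // l ≠ k} := ⟨l, fun h => hne (by rw [h])⟩
  have hedge := mobius_edgeSet hm hAB hlt hadj hcover
  have hinj := mobius_edge_injective hm hA hAB hlt hdist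
  let A' : {l // l ≠ k} → ℕ := fun l => A l
  let B' : {l // l ≠ k} → ℕ := fun l => B l
  have hA' : StrictMono A' := fun _ _ h => hA h
  have hB' : StrictMono B' := fun _ _ h => hB h
  have hedge' : (Γ.deleteEdges {s(ψ (A k), ψ (B k))}).edgeSet =
      Set.range fun e => s(ψ (mobiusSrc m A' e), ψ (mobiusTgt m B' e)) := by
    have hinj' := (Sym2.map.injective ψ.injective).comp hinj
    rw [SimpleGraph.edgeSet_deleteEdges, hedge]
    ext e
    constructor
    · rintro ⟨⟨i | l, rfl⟩, hne⟩
      · exact ⟨.inl i, rfl⟩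
      · exact ⟨.inr ⟨l, fun h => hne (by rw [h]; rfl)⟩, rfl⟩
    · rintro ⟨i | l, rfl⟩
      · exact ⟨⟨.inl i, rfl⟩, fun h => by simpa using @hinj' (.inl i) (.inr k) h⟩
      · exact ⟨⟨.inr l, rfl⟩, fun h => l.2 (by simpa using @hinj' (.inr l) (.inr k) h)⟩
  rw [hasNowhereZero3Flow_iff_of_embedding ψ hinj hedge,
    mobius_exists_edgeOutflow_iff hA hB hAB hlt,
    hasNowhereZero3Flow_iff_of_embedding ψ
      (mobius_edge_injective hm hA' (fun _ _ => hAB _ _) (fun l => hlt l) fun l => hdist l) hedge',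
    mobius_exists_edgeOutflow_iff hA' hB' (fun _ _ => hAB _ _) fun l => hlt l,
    ← card_subtype_ne_add_one k, Nat.odd_add_one]

end DeleteRung

/-- Let `Γ` be a generalized circular ladder with at least one rung, or a generalized
Möbius ladder with at least two rungs, and let `e` be a rung of `Γ`.  Then `Γ` admits a
nowhere-zero 3-flow iff `Γ - e` does not. -/
theorem genClosedLadder_delete_rung_nowhere_zero_3_flow
    {V : Type*} [Fintype V] (Γ : SimpleGraph V) (R : Set (Sym2 V))
    (h : (IsGenCircularLadder Γ R ∧ R.Nonempty) ∨ (IsGenMobiusLadder Γ R ∧ R.Nontrivial))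
    (e : Sym2 V) (he : e ∈ R) :
    HasNowhereZero3Flow Γ ↔ ¬ HasNowhereZero3Flow (Γ.deleteEdges {e}) := by
  rcases h with ⟨h, -⟩ | ⟨h, hR⟩
  · exact h.delete_rung he
  · exact h.delete_rung hR he
end

section
/- Let G be a finite group. If the derived (commutator) subgroup G' of G has square-free order, then G is supersolvable. -/
/-- A finite group is supersolvable if it has a chain of subgroups from `⊥` to `⊤`,
each normal in the whole group, with all successive quotients cyclic. -/
def IsSupersolvable (G : Type*) [Group G] : Prop :=
  ∃ (n : ℕ) (c : Fin (n + 1) → Subgroup G) (hc : ∀ i, (c i).Normal),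
    Monotone c ∧ c 0 = ⊥ ∧ c (Fin.last n) = ⊤ ∧
    ∀ i : Fin n,
      IsCyclic ↥(Subgroup.map (@QuotientGroup.mk' G _ (c i.castSucc) (hc i.castSucc)) (c i.succ))

/-- The relation on subgroups saying that both are normal, the first is contained in the second,
and the quotient is cyclic. -/
def NormalCyclicStep {G : Type*} [Group G] (K L : Subgroup G) : Prop :=
  K ≤ L ∧ L.Normal ∧ ∃ hK : K.Normal, IsCyclic ↥(Subgroup.map (@QuotientGroup.mk' G _ K hK) L)

theorem isSupersolvable_of_reflTransGen {G : Type*} [Group G]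
    (h : Relation.ReflTransGen NormalCyclicStep (⊥ : Subgroup G) ⊤) : IsSupersolvable G := by
  suffices H : ∀ L : Subgroup G, Relation.ReflTransGen NormalCyclicStep ⊥ L →
      ∃ s : RelSeries {x : Subgroup G × Subgroup G | NormalCyclicStep x.1 x.2},
        s.head = ⊥ ∧ s.last = L by
    obtain ⟨s, hs, hl⟩ := H ⊤ h
    have hstep (i : Fin s.length) : NormalCyclicStep (s i.castSucc) (s i.succ) := s.step i
    refine ⟨s.length, s, fun i ↦ ?_, Fin.monotone_iff_le_succ.2 fun i ↦ (hstep i).1, hs, hl,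
      fun i ↦ (hstep i).2.2.2⟩
    induction i using Fin.cases with
    | zero =>
      have h0 : s 0 = ⊥ := hs
      rw [h0]
      infer_instance
    | succ i => exact (hstep i).2.1
  intro L hL
  induction hL with
  | refl => exact ⟨RelSeries.singleton _ ⊥, rfl, rfl⟩
  | @tail K L _ hKL ih =>
    obtain ⟨s, hs, rfl⟩ := ih
    exact ⟨s.snoc L hKL, by simpa using hs, by simp⟩

theorem normalCyclicStep_sup_zpowers {G : Type*} [Group G] {K : Subgroup G}
    (hK : commutator G ≤ K) (g : G) : NormalCyclicStep K (K ⊔ Subgroup.zpowers g) := by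
  have : K.Normal := Subgroup.Normal.of_commutator_le G hK
  refine ⟨le_sup_left, Subgroup.Normal.of_commutator_le G (hK.trans le_sup_left), this, ?_⟩
  rw [Subgroup.map_sup, (Subgroup.map_eq_bot_iff K).2 (QuotientGroup.ker_mk' K).ge, bot_sup_eq,
    MonoidHom.map_zpowers]
  infer_instance

theorem reflTransGen_normalCyclicStep_top {G : Type*} [Group G] [Finite G] (K : Subgroup G)
    (hK : commutator G ≤ K) : Relation.ReflTransGen NormalCyclicStep K ⊤ := by
  induction K using WellFoundedGT.induction with
  | ind K ih =>
    by_cases hT : K = ⊤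
    · rw [hT]
    · obtain ⟨g, hg⟩ : ∃ g, g ∉ K := by
        by_contra! hall
        exact hT ((Subgroup.eq_top_iff' K).2 hall)
      have hlt : K < K ⊔ Subgroup.zpowers g :=
        left_lt_sup.2 fun hle ↦ hg (hle (Subgroup.mem_zpowers g))
      exact .head (normalCyclicStep_sup_zpowers hK g) (ih _ hlt (hK.trans hlt.le))

/-- A finite group whose derived subgroup has square-free order is supersolvable. -/
theorem supersolvable_of_squarefree_commutator {G : Type*} [Group G] [Fintype G]
    (h : Squarefree (Nat.card ↥(commutator G))) : IsSupersolvable G := by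
  have hZ : IsZGroup ↥(commutator G) := .of_squarefree h
  set D : Subgroup G := ⁅commutator G, commutator G⁆
  have hDN : D.Normal := Subgroup.commutator_normal _ _
  have hmap : (commutator ↥(commutator G)).map (commutator G).subtype = D := by
    rw [commutator_def ↥(commutator G), Subgroup.map_commutator, ← MonoidHom.range_eq_map,
      Subgroup.range_subtype]
  have hDcyc : IsCyclic D := by
    have := IsZGroup.isCyclic_commutator (G := ↥(commutator G))
    rw [← hmap]
    exact isCyclic_of_surjective _ ((commutator G).subtype.subgroupMap_surjective _)
  have hDle : D ≤ commutator G := Subgroup.commutator_le_right _ _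
  have hbot : NormalCyclicStep ⊥ D := by
    refine ⟨bot_le, hDN, inferInstance, ?_⟩
    exact isCyclic_of_surjective _ ((QuotientGroup.mk' (⊥ : Subgroup G)).subgroupMap_surjective D)
  have hstep : NormalCyclicStep D (commutator G) := by
    refine ⟨hDle, inferInstance, hDN, ?_⟩
    let f := (QuotientGroup.mk' D).subgroupMap (commutator G)
    have hker : commutator ↥(commutator G) ≤ f.ker := fun x hx ↦ by
      rw [MonoidHom.mem_ker, Subtype.ext_iff]
      exact (QuotientGroup.eq_one_iff _).2 (hmap ▸ Subgroup.mem_map_of_mem _ hx)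
    have : IsCyclic (↥(commutator G) ⧸ commutator ↥(commutator G)) :=
      IsZGroup.isCyclic_abelianization (G := ↥(commutator G))
    exact isCyclic_of_surjective (G' := ↥(commutator G) ⧸ commutator ↥(commutator G))
      (QuotientGroup.lift _ f hker)
      (QuotientGroup.lift_surjective_of_surjective _ _
        ((QuotientGroup.mk' D).subgroupMap_surjective _) hker)
  exact isSupersolvable_of_reflTransGen
    (.head hbot (.head hstep (reflTransGen_normalCyclicStep_top _ le_rfl)))
end

section
/- Let G be a finite supersolvable group having a noncyclic Sylow 2-subgroup, and let N be a normal subgroup of G contained in the derived subgroup G'. Then every Sylow 2-subgroup of the quotient group G/N is noncyclic. -/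
namespace Subgroup

variable {G : Type*} [Group G]

theorem mem_of_coprime_orderOf_index {K : Subgroup G} [K.Normal] {x : G}
    (h : (orderOf x).Coprime K.index) : x ∈ K := by
  rw [← QuotientGroup.eq_one_iff, ← orderOf_eq_one_iff]
  exact Nat.eq_one_of_dvd_coprimes h (orderOf_map_dvd (QuotientGroup.mk' K) x)
    (_root_.orderOf_dvd_natCard _)

theorem characteristic_of_coprime_card_index {K : Subgroup G} [K.Normal]
    (h : (Nat.card K).Coprime K.index) : K.Characteristic := by
  refine characteristic_iff_map_le.mpr fun φ => map_le_iff_le_comap.mpr fun x hx => ?_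
  refine mem_comap.mpr (mem_of_coprime_orderOf_index (h.coprime_dvd_left ?_))
  rw [MulEquiv.coe_toMonoidHom, MulEquiv.orderOf_eq]
  exact K.orderOf_dvd_natCard hx

theorem exists_characteristic_odd_card_of_isCyclic_of_odd_index [Finite G] (A : Subgroup G)
    [A.Normal] [IsCyclic A] (hA : Odd A.index) :
    ∃ K : Subgroup G, K.Characteristic ∧ Odd (Nat.card K) ∧ ∃ k, K.index = 2 ^ k := by
  rcases Nat.even_or_odd (Nat.card G) with hG | hG
  · have hmin : (Nat.card G).minFac = 2 := (Nat.minFac_eq_two_iff _).mpr hG.two_dvd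
    let P : Sylow 2 G := default
    obtain ⟨k, hk⟩ := P.2.exists_card_eq
    have hPA : (P : Subgroup G) ≤ A := fun x hx => by
      refine mem_of_coprime_orderOf_index (Nat.Coprime.coprime_dvd_left
        ((P : Subgroup G).orderOf_dvd_natCard hx) ?_)
      rw [hk]
      exact hA.coprime_two_left.pow_left k
    have hP : IsCyclic P := isCyclic_of_injective (inclusion hPA) (inclusion_injective hPA)
    have hc := hP.isComplement' hmin
    set K := (MonoidHom.transferSylow P (hP.normalizer_le_centralizer hmin)).ker
    have hindex : K.index = 2 ^ k := hc.symm.index_eq_card.trans hk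
    have hodd : Odd (Nat.card K) := by
      rw [← hc.index_eq_card, ← Nat.not_even_iff_odd, even_iff_two_dvd]
      exact P.not_dvd_index
    refine ⟨K, characteristic_of_coprime_card_index ?_, hodd, k, hindex⟩
    rw [hindex]
    exact hodd.coprime_two_right.pow_right k
  · exact ⟨⊤, inferInstance, by rwa [card_top], 0, by simp⟩

theorem exists_normal_odd_card_of_isCyclic_of_odd_relIndex [Finite G] (A M : Subgroup G)
    [A.Normal] [M.Normal] [IsCyclic A] (hAM : A ≤ M) (hodd : Odd (A.relIndex M)) :
    ∃ K ≤ M, K.Normal ∧ Odd (Nat.card K) ∧ ∃ k, K.relIndex M = 2 ^ k := by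
  have : IsCyclic (A.subgroupOf M) :=
    isCyclic_of_injective (subgroupOfEquivOfLe hAM).toMonoidHom
      (subgroupOfEquivOfLe hAM).injective
  obtain ⟨K, hK, hcard, k, hk⟩ :=
    exists_characteristic_odd_card_of_isCyclic_of_odd_index (A.subgroupOf M) hodd
  refine ⟨K.map M.subtype, map_subtype_le K, inferInstance, ?_, k, ?_⟩
  · rwa [card_map_of_injective M.subtype_injective]
  · rw [relIndex, ← comap_subtype, comap_map_eq_self_of_injective M.subtype_injective, hk]

theorem map_commutator_le {H : Type*} [Group H] (f : G →* H) :
    (_root_.commutator G).map f ≤ _root_.commutator H := by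
  rw [_root_.commutator_def, map_commutator]
  exact commutator_mono le_top le_top

theorem eq_top_of_sup_commutator_eq_top [Finite G] [Group.IsNilpotent G] {H : Subgroup G}
    (h : H ⊔ _root_.commutator G = ⊤) : H = ⊤ := by
  by_contra hH
  obtain ⟨C, hC, hHC⟩ := (eq_top_or_exists_le_coatom H).resolve_left hH
  have := NormalizerCondition.normal_of_coatom C Group.normalizerCondition_of_isNilpotent hC
  have : Nontrivial (G ⧸ C) := QuotientGroup.nontrivial_iff.mpr hC.1
  have hlt := Group.IsSolvable.commutator_lt_top_of_nontrivial (G ⧸ C)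
  refine hlt.ne (eq_top_iff.mpr ?_)
  rw [← map_top_of_surjective _ (QuotientGroup.mk'_surjective C), ← h, map_sup]
  refine sup_le ?_ ?_
  · refine (map_mono hHC).trans ?_
    rw [QuotientGroup.map_mk'_self]
    exact bot_le
  · exact map_commutator_le _

end Subgroup

/-- A finite supersolvable group has a normal `2`-complement. -/
theorem IsSupersolvable.exists_normal_two_complement {G : Type*} [Group G] [Finite G]
    (h : IsSupersolvable G) :
    ∃ K : Subgroup G, K.Normal ∧ Odd (Nat.card K) ∧ ∃ k, K.index = 2 ^ k := by
  obtain ⟨n, c, hc, hmono, hbot, htop, hcyc⟩ := h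
  have key : ∀ i : Fin (n + 1), ∃ M : Subgroup G, M.Normal ∧ c i ≤ M ∧
      Odd ((c i).relIndex M) ∧ ∃ k, M.index = 2 ^ k := by
    intro i
    induction i using Fin.reverseInduction with
    | last => exact ⟨⊤, inferInstance, le_top, by simp [htop], 0, by simp⟩
    | cast i ih =>
      obtain ⟨M, hM, hle, hodd, k, hk⟩ := ih
      have := hc i.castSucc
      have := hc i.succ
      have := hcyc i
      set π := QuotientGroup.mk' (c i.castSucc)
      have hπ : Function.Surjective π := QuotientGroup.mk'_surjective _
      have hker : π.ker = c i.castSucc := QuotientGroup.ker_mk' _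
      have hlt : c i.castSucc ≤ c i.succ := hmono i.castSucc_lt_succ.le
      have : (M.map π).Normal := hM.map π hπ
      have : ((c i.succ).map π).Normal := (hc i.succ).map π hπ
      obtain ⟨K, hKM, hK, hcard, l, hl⟩ :=
        Subgroup.exists_normal_odd_card_of_isCyclic_of_odd_relIndex ((c i.succ).map π) (M.map π)
          (Subgroup.map_mono hle) (by
            rwa [Subgroup.relIndex_map_map, hker, sup_eq_left.mpr hlt,
              sup_eq_left.mpr (hlt.trans hle)])
      refine ⟨K.comap π, hK.comap π, ?_, ?_, l + k, ?_⟩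
      · exact hker.ge.trans (Subgroup.ker_le_comap π K)
      · have hrel := Subgroup.relIndex_ker π (K := K.comap π)
        rw [hker] at hrel
        rwa [hrel, Subgroup.map_comap_eq_self_of_surjective hπ]
      · rw [Subgroup.index_comap_of_surjective K hπ, ← Subgroup.relIndex_mul_index hKM, hl,
          Subgroup.index_map_eq M hπ (hker.trans_le (hlt.trans hle)), hk, pow_add]
  obtain ⟨K, hK, -, hodd, hk⟩ := key 0
  exact ⟨K, hK, by simpa [hbot] using hodd, hk⟩

/-- A finite nilpotent group with a cyclic quotient by a subgroup of its derived subgroup is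
cyclic. -/
theorem isCyclic_of_isCyclic_quotient_of_le_commutator {G : Type*} [Group G] [Finite G]
    [Group.IsNilpotent G] (N : Subgroup G) [N.Normal] (hN : N ≤ commutator G)
    [IsCyclic (G ⧸ N)] : IsCyclic G := by
  obtain ⟨q, hq⟩ := IsCyclic.exists_zpow_surjective (G := G ⧸ N)
  obtain ⟨g, rfl⟩ := QuotientGroup.mk'_surjective N q
  rw [isCyclic_iff_exists_zpowers_eq_top]
  refine ⟨g, Subgroup.eq_top_of_sup_commutator_eq_top (eq_top_iff.mpr fun x _ => ?_)⟩
  obtain ⟨m, hm⟩ := hq (QuotientGroup.mk' N x)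
  have hx : (g ^ m)⁻¹ * x ∈ N := QuotientGroup.eq.mp (by simpa using hm)
  rw [← mul_inv_cancel_left (g ^ m) x]
  exact Subgroup.mul_mem_sup (Subgroup.zpow_mem_zpowers g m) (hN hx)

/-- If `G` is a finite supersolvable group with noncyclic Sylow 2-subgroups and `N` is a
normal subgroup of `G` contained in the derived subgroup, then every Sylow 2-subgroup of
`G / N` is noncyclic. -/
theorem quotient_sylow_two_noncyclic {G : Type*} [Group G] [Fintype G]
    (hss : IsSupersolvable G)
    (hsyl : ∀ P : Sylow 2 G, ¬ IsCyclic ↥(P : Subgroup G))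
    (N : Subgroup G) [N.Normal] (hN : N ≤ commutator G) :
    ∀ Q : Sylow 2 (G ⧸ N), ¬ IsCyclic ↥(Q : Subgroup (G ⧸ N)) := by
  intro Q hQ
  obtain ⟨K, hK, hodd, k, hk⟩ := hss.exists_normal_two_complement
  set π := QuotientGroup.mk' K
  have hπ : Function.Surjective π := QuotientGroup.mk'_surjective K
  have hp : IsPGroup 2 (G ⧸ K) := IsPGroup.of_card hk
  have : Group.IsNilpotent (G ⧸ K) := hp.isNilpotent
  have : (N.map π).Normal := Subgroup.Normal.map inferInstance π hπ
  let ψ : G ⧸ N →* (G ⧸ K) ⧸ N.map π :=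
    QuotientGroup.map N (N.map π) π (Subgroup.le_comap_map π N)
  have hψ : Function.Surjective ψ := QuotientGroup.map_surjective_of_surjective _ _ _
    ((QuotientGroup.mk'_surjective _).comp hπ) _
  have hQtop : (Q : Subgroup (G ⧸ N)).map ψ = ⊤ := by
    rw [← Sylow.coe_mapSurjective hψ]
    exact ((Q.mapSurjective hψ).is_maximal' ((hp.to_quotient _).to_subgroup ⊤) le_top).symm
  have : IsCyclic ((G ⧸ K) ⧸ N.map π) := by
    refine isCyclic_of_surjective (ψ.comp (Q : Subgroup (G ⧸ N)).subtype) ?_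
    rw [← MonoidHom.range_eq_top, MonoidHom.range_comp, Subgroup.range_subtype, hQtop]
  have : IsCyclic (G ⧸ K) := by
    refine isCyclic_of_isCyclic_quotient_of_le_commutator (N.map π)
      ((Subgroup.map_mono hN).trans ?_)
    exact Subgroup.map_commutator_le π
  let P : Sylow 2 G := default
  refine hsyl P (isCyclic_of_injective (π.comp (P : Subgroup G).subtype) ?_)
  rw [injective_iff_map_eq_one]
  intro x hx
  obtain ⟨m, hm⟩ := P.2.exists_card_eq
  have hxK : (x : G) ∈ K := (QuotientGroup.eq_one_iff (x : G)).mp hx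
  have hcop : (2 ^ m).Coprime (Nat.card K) := hodd.coprime_two_left.pow_left m
  rw [← OneMemClass.coe_eq_one, ← orderOf_eq_one_iff]
  exact Nat.eq_one_of_dvd_coprimes hcop (hm ▸ (P : Subgroup G).orderOf_dvd_natCard x.2)
    (K.orderOf_dvd_natCard hxK)
end

section
/- Let G be a finite group of order at least 4 and let X ⊆ G \ {1} be a generating set of G with X = X⁻¹ and |X| = 3 (so the Cayley graph Cay(G,X) is connected and cubic). If some element x ∈ X has prime order and the cyclic subgroup ⟨x⟩ is normal in G, then Cay(G,X) is isomorphic (as a graph) to the circular ladder CL_n for some n ≥ 3 or to the Möbius ladder M_n for some n ≥ 2. -/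
/-- The Cayley graph of a group with connection set `X`: `g` and `h` are adjacent
iff `g⁻¹ * h ∈ X` (for `X` inverse-closed with `1 ∉ X` this is symmetric and loopless). -/
def cayleyGraph {G : Type*} [Group G] (X : Set G) : SimpleGraph G :=
  SimpleGraph.fromRel (fun g h => g⁻¹ * h ∈ X)

/-- The circular ladder `CL_n` on vertex set `ZMod n × ZMod 2`. -/
def circularLadder (n : ℕ) : SimpleGraph (ZMod n × ZMod 2) :=
  SimpleGraph.fromRel (fun p q => (p.2 = q.2 ∧ q.1 = p.1 + 1) ∨ (p.1 = q.1 ∧ p.2 ≠ q.2))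

/-- The Möbius ladder `M_n` on vertex set `ZMod (2n)`. -/
def mobiusLadder (n : ℕ) : SimpleGraph (ZMod (2 * n)) :=
  SimpleGraph.fromRel (fun i j => j = i + 1 ∨ j = i + (n : ZMod (2 * n)))

namespace CayleyLadder

variable {G : Type*} [Group G]

/-- A two-way infinite walk in `Cay(G, {y, z})` that leaves each vertex along the generator
other than the one it arrived by. -/
def IsTrail (y z : G) (w : ℤ → G) : Prop :=
  ∀ i, s(w (i - 1), w (i + 1)) = s(w i * y, w i * z)

theorem exists_isTrail {y z : G} (h : s(y⁻¹, z⁻¹) = s(y, z)) : ∃ w, IsTrail y z w := by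
  rcases Sym2.eq_iff.1 h with ⟨hy, hz⟩ | ⟨hy, -⟩
  · refine ⟨fun i => (y * z) ^ (i / 2) * if Even i then 1 else y, fun i => ?_⟩
    have hyy : y * y = 1 := inv_eq_iff_mul_eq_one.1 hy
    have hzy : (y * z)⁻¹ * y = z := by simp [hz]
    obtain ⟨k, rfl | rfl⟩ := Int.even_or_odd' i
    · have e₁ : (2 * k - 1) / 2 = k - 1 := by lia
      have e₂ : (2 * k + 1) / 2 = k := by lia
      have e₃ : 2 * k / 2 = k := by lia
      have o₁ : ¬ Even (2 * k - 1) := by rw [Int.even_iff]; lia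
      have o₂ : ¬ Even (2 * k + 1) := by rw [Int.even_iff]; lia
      simp only [e₁, e₂, e₃, o₁, o₂, even_two_mul, if_true, if_false, mul_one, zpow_sub_one,
        mul_assoc ((y * z) ^ k), hzy]
      exact Sym2.eq_swap
    · have e₁ : (2 * k + 1 - 1) / 2 = k := by lia
      have e₂ : (2 * k + 1 + 1) / 2 = k + 1 := by lia
      have e₃ : (2 * k + 1) / 2 = k := by lia
      have o₁ : Even (2 * k + 1 - 1) := by rw [Int.even_iff]; lia
      have o₂ : Even (2 * k + 1 + 1) := by rw [Int.even_iff]; lia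
      have o₃ : ¬ Even (2 * k + 1) := by rw [Int.even_iff]; lia
      simp only [e₁, e₂, e₃, o₁, o₂, o₃, if_true, if_false, mul_one, zpow_add_one, mul_assoc, hyy]
  · exact ⟨fun i => y ^ i, fun i => by simp [zpow_sub_one, zpow_add_one, ← hy, Sym2.eq_swap]⟩

namespace IsTrail

variable {y z u : G} {w : ℤ → G}

theorem eq_mul_or (hw : IsTrail y z w) (i : ℤ) (g : G) :
    g = w (i + 1) ∨ g = w (i - 1) ↔ g = w i * y ∨ g = w i * z := by
  rw [or_comm, ← Sym2.mem_iff, hw i, Sym2.mem_iff]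

theorem succ_ne (hw : IsTrail y z w) (hyz : y ≠ z) (i : ℤ) : w (i - 1) ≠ w (i + 1) := by
  intro h
  have := hw i
  rw [h, Sym2.eq_iff] at this
  apply hyz
  rcases this with ⟨h₁, h₂⟩ | ⟨h₁, h₂⟩
  · exact mul_left_cancel (h₁.symm.trans h₂)
  · exact mul_left_cancel (h₂.symm.trans h₁)

theorem mul_right (hw : IsTrail y z w) (hu : s(u * y, u * z) = s(y * u, z * u)) :
    IsTrail y z fun i => w i * u := by
  intro i
  have h₁ := congrArg (Sym2.map (· * u)) (hw i)
  have h₂ := congrArg (Sym2.map (w i * ·)) hu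
  simp only [Sym2.map_mk, ← mul_assoc] at h₁ h₂
  exact h₁.trans h₂.symm

theorem neg (hw : IsTrail y z w) : IsTrail y z fun i => w (-i) := by
  intro i
  have := hw (-i)
  rw [Sym2.eq_swap, ← this]
  congr 3 <;> lia

theorem shift (hw : IsTrail y z w) (d : ℤ) : IsTrail y z fun i => w (i + d) := by
  intro i
  rw [← hw (i + d)]
  ring_nf

theorem eq_of_eq {v : ℤ → G} (hw : IsTrail y z w) (hv : IsTrail y z v) (h₀ : w 0 = v 0)
    (h₁ : w 1 = v 1) (k : ℤ) : w k = v k := by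
  suffices w k = v k ∧ w (k + 1) = v (k + 1) from this.1
  induction k using Int.induction_on with
  | zero => simpa using ⟨h₀, h₁⟩
  | succ i ih =>
    refine ⟨ih.2, ?_⟩
    have a := hw (i + 1)
    rw [ih.2, ← hv (i + 1)] at a
    simp only [add_sub_cancel_right, ih.1] at a
    exact Sym2.congr_right.1 a
  | pred i ih =>
    simp only [sub_add_cancel]
    refine ⟨?_, ih.1⟩
    have a := hw (-i)
    rw [ih.1, ← hv (-i), ih.2] at a
    exact Sym2.congr_left.1 a

/-- Two trails through a common vertex agree up to a translation or a reflection. -/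
theorem translate_or_reflect {v : ℤ → G} (hw : IsTrail y z w) (hv : IsTrail y z v) {i j : ℤ}
    (h : v i = w j) : (∀ k, v (k + i) = w (k + j)) ∨ ∀ k, v (k + i) = w (-k + j) := by
  have h₁ : v (i + 1) = w (j + 1) ∨ v (i + 1) = w (j - 1) := by
    rw [hw.eq_mul_or, ← h, ← hv.eq_mul_or]
    exact .inl rfl
  refine h₁.imp (fun h₁ => ?_) fun h₁ => ?_
  · exact eq_of_eq (hv.shift i) (hw.shift j) (by simpa using h) (by simpa [add_comm] using h₁)
  · exact eq_of_eq (hv.shift i) (hw.shift j).neg (by simpa using h)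
      (by simpa [add_comm, sub_eq_add_neg] using h₁)

theorem mul_translate (hw : IsTrail y z w) (hu : s(u * y, u * z) = s(y * u, z * u)) (hu₁ : u ≠ 1)
    (huy : u ≠ y) (huz : u ≠ z) {i j : ℤ} (h : w i * u = w j) (k : ℤ) :
    w k * u = w (k + (j - i)) := by
  rcases hw.translate_or_reflect (hw.mul_right hu) h with H | H
  · have := H (k - i)
    rw [sub_add_cancel] at this
    rw [this]
    congr 1
    ring
  · exfalso
    obtain ⟨m, hm | hm⟩ := Int.even_or_odd' (j - i)
    · have := H m
      rw [show -m + j = m + i by lia] at this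
      exact hu₁ (by simpa using this)
    · have := (hw.eq_mul_or (m + i) _).1 (.inl ((H m).trans (congrArg w (by lia))))
      simp [huy, huz] at this

theorem exists_period [Finite G] (hw : IsTrail y z w) (hyz : y ≠ z) (hy : y ≠ 1) (hz : z ≠ 1) :
    ∃ n : ℕ, 3 ≤ n ∧ ∀ i j, w i = w j ↔ (i : ZMod n) = j := by
  have key : ∀ {i j}, w i = w j → ∀ k, w (k + i) = w (k + j) := by
    intro i j h
    refine (hw.translate_or_reflect hw h).resolve_right fun H => ?_
    obtain ⟨m, hm | hm⟩ := Int.even_or_odd' (j - i)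
    · refine hw.succ_ne hyz (m + i) ?_
      have := H (m - 1)
      convert this using 2 <;> lia
    · have := (hw.eq_mul_or (m + i) _).1 (.inl ((H m).trans (congrArg w (by lia))))
      simp [hy, hz] at this
  let P : AddSubgroup ℤ :=
    { carrier := {d | ∀ k, w (k + d) = w k}
      zero_mem' := by simp
      add_mem' := fun {a b} ha hb k => by rw [← add_assoc, hb, ha]
      neg_mem' := fun {a} ha k => by rw [← ha (k + -a), neg_add_cancel_right] }
  obtain ⟨a, ha⟩ := Int.subgroup_cyclic P
  have hP : ∀ i j, w i = w j ↔ (i : ZMod a.natAbs) = j := by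
    intro i j
    rw [ZMod.intCast_eq_intCast_iff_dvd_sub, Int.natAbs_dvd, ← Int.mem_zmultiples_iff,
      AddSubgroup.zmultiples_eq_closure, ← ha]
    refine ⟨fun h k => ?_, fun h => ?_⟩
    · have := key h (k - i)
      rw [sub_add_cancel] at this
      rw [this]
      congr 1
      ring
    · rw [← h i, add_sub_cancel]
  refine ⟨a.natAbs, ?_, hP⟩
  by_contra! hlt
  have h₂ : w (0 - 1) ≠ w (0 + 1) := hw.succ_ne hyz 0
  have h₁ : w (0 + 1) ≠ w 0 := fun h => by
    have := (hw.eq_mul_or 0 _).1 (.inl h.symm)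
    simp [hy, hz] at this
  have h₀ : ¬ Function.Injective w := not_injective_infinite_finite w
  rw [Ne, hP] at h₁ h₂
  generalize a.natAbs = n at *
  interval_cases n
  · exact h₀ fun i j h => by simpa using (hP i j).1 h
  · exact h₁ (Subsingleton.elim _ _)
  · exact h₂ (by decide)

theorem forall_exists [Finite G] (hw : IsTrail y z w)
    (hinv : s(y⁻¹, z⁻¹) = s(y, z)) (hu : s(u * y, u * z) = s(y * u, z * u))
    (huu : u * u = 1) (hgen : Subgroup.closure {u, y, z} = ⊤) (g : G) :
    ∃ i, g = w i ∨ g = w i * u := by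
  have step : ∀ {g s : G}, (∃ i, g = w i ∨ g = w i * u) → s = u ∨ s = y ∨ s = z →
      ∃ i, g * s = w i ∨ g * s = w i * u := by
    rintro g s ⟨i, rfl | rfl⟩ (rfl | hs)
    · exact ⟨i, .inr rfl⟩
    · rcases (hw.eq_mul_or i (w i * s)).2 (by simpa using hs) with h | h
      exacts [⟨_, .inl h⟩, ⟨_, .inl h⟩]
    · exact ⟨i, .inl (by rw [mul_assoc, huu, mul_one])⟩
    · rcases ((hw.mul_right hu).eq_mul_or i (w i * u * s)).2 (by simpa using hs) with h | h
      exacts [⟨_, .inr h⟩, ⟨_, .inr h⟩]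
  have hs : ∀ s, s = u ∨ s = y ∨ s = z → s⁻¹ = u ∨ s⁻¹ = y ∨ s⁻¹ = z := by
    rintro s (rfl | h)
    · exact .inl (inv_eq_of_mul_eq_one_left huu)
    · right
      rw [← Sym2.mem_iff, ← hinv]
      simpa using h
  suffices ∀ g, ∃ i, w 0 * g = w i ∨ w 0 * g = w i * u by simpa using this ((w 0)⁻¹ * g)
  intro g
  have hg : g ∈ Subgroup.closure {u, y, z} := hgen ▸ Subgroup.mem_top g
  induction hg using Subgroup.closure_induction_right with
  | one => exact ⟨0, by simp⟩
  | mul_right g _ s h ih => rw [← mul_assoc]; exact step ih h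
  | mul_inv_cancel g _ s h ih => rw [← mul_assoc]; exact step ih (hs s h)

end IsTrail

theorem cayleyGraph_adj {X : Set G} (h₁ : 1 ∉ X) (hX : ∀ s ∈ X, s⁻¹ ∈ X) {g h : G} :
    (cayleyGraph X).Adj g h ↔ g⁻¹ * h ∈ X := by
  rw [cayleyGraph, SimpleGraph.fromRel_adj]
  constructor
  · rintro ⟨-, h | h⟩
    · exact h
    · simpa using hX _ h
  · intro h
    refine ⟨?_, .inl h⟩
    rintro rfl
    simp [h₁] at h

theorem circularLadder_adj {n : ℕ} [Fact (1 < n)] {p q : ZMod n × ZMod 2} :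
    (circularLadder n).Adj p q ↔
      (q.1 = p.1 ∧ q.2 = p.2 + 1) ∨ (q.2 = p.2 ∧ (q.1 = p.1 + 1 ∨ q.1 = p.1 - 1)) := by
  have h2 : ∀ a b : ZMod 2, a ≠ b ↔ b = a + 1 := by decide
  rw [circularLadder, SimpleGraph.fromRel_adj, h2, h2]
  obtain ⟨a, b⟩ := p
  obtain ⟨c, d⟩ := q
  have h1 : (1 : ZMod n) ≠ 0 := one_ne_zero
  have h1' : (1 : ZMod 2) ≠ 0 := one_ne_zero
  have h2' : (1 : ZMod 2) + 1 = 0 := by decide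
  simp only [Ne, Prod.mk.injEq]
  grind

theorem mobiusLadder_adj {n : ℕ} (hn : 2 ≤ n) {i j : ZMod (2 * n)} :
    (mobiusLadder n).Adj i j ↔ j = i + n ∨ j = i + 1 ∨ j = i - 1 := by
  have : Fact (1 < 2 * n) := ⟨by lia⟩
  have h1 : (1 : ZMod (2 * n)) ≠ 0 := one_ne_zero
  have hn0 : (n : ZMod (2 * n)) ≠ 0 := fun h => by
    have := Nat.le_of_dvd (by lia) ((ZMod.natCast_eq_zero_iff _ _).1 h)
    lia
  have hnn : (n : ZMod (2 * n)) + n = 0 := by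
    rw [← Nat.cast_add, ← two_mul, ZMod.natCast_self]
  rw [mobiusLadder, SimpleGraph.fromRel_adj]
  grind

/-- A cubic Cayley graph whose connection set consists of an involution `u` and an
inverse-closed pair `{y, z}` normalised by `u` is a circular or a Möbius ladder. -/
theorem exists_iso_ladder [Finite G] {u y z : G} (hyz : y ≠ z) (hy : y ≠ 1) (hz : z ≠ 1)
    (hu₁ : u ≠ 1) (huy : u ≠ y) (huz : u ≠ z) (huu : u * u = 1)
    (hinv : s(y⁻¹, z⁻¹) = s(y, z)) (hu : s(u * y, u * z) = s(y * u, z * u))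
    (hgen : Subgroup.closure {u, y, z} = ⊤) :
    (∃ n, 3 ≤ n ∧ Nonempty (cayleyGraph {u, y, z} ≃g circularLadder n)) ∨
    (∃ n, 2 ≤ n ∧ Nonempty (cayleyGraph {u, y, z} ≃g mobiusLadder n)) := by
  obtain ⟨w, hw⟩ := exists_isTrail hinv
  obtain ⟨N, hN, hper⟩ := hw.exists_period hyz hy hz
  have hsurj := hw.forall_exists hinv hu huu hgen
  have : NeZero N := ⟨by lia⟩
  have : Fact (1 < N) := ⟨by lia⟩
  have hadj : ∀ g h, (cayleyGraph {u, y, z}).Adj g h ↔ h = g * u ∨ h = g * y ∨ h = g * z := by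
    intro g h
    rw [cayleyGraph_adj]
    · simp [inv_mul_eq_iff_eq_mul]
    · simp [hu₁.symm, hy.symm, hz.symm]
    · rintro s (rfl | h)
      · exact .inl (inv_eq_of_mul_eq_one_left huu)
      · right
        change s⁻¹ = y ∨ s⁻¹ = z
        rw [← Sym2.mem_iff, ← hinv]
        simpa using h
  obtain ⟨f, hf⟩ : ∃ f : ZMod N → G, ∀ i : ℤ, f i = w i :=
    ⟨fun a => w a.cast, fun i => by rw [hper]; simp⟩
  have hfinj : Function.Injective f := by
    intro a b h
    obtain ⟨i, rfl⟩ := ZMod.intCast_surjective a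
    obtain ⟨j, rfl⟩ := ZMod.intCast_surjective b
    rwa [hf, hf, hper] at h
  have hfn : ∀ a g, g = f a * y ∨ g = f a * z ↔ g = f (a + 1) ∨ g = f (a - 1) := by
    intro a g
    obtain ⟨i, rfl⟩ := ZMod.intCast_surjective a
    have := hw.eq_mul_or i g
    rw [← hf, ← hf, ← hf] at this
    push_cast at this
    exact this.symm
  have hfun : ∀ a g, g = f a * u * y ∨ g = f a * u * z ↔
      g = f (a + 1) * u ∨ g = f (a - 1) * u := by
    intro a g
    obtain ⟨i, rfl⟩ := ZMod.intCast_surjective a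
    have := (hw.mul_right hu).eq_mul_or i g
    simp only [← hf] at this
    push_cast at this
    exact this.symm
  by_cases hdisj : ∃ a b, f a * u = f b
  · right
    obtain ⟨a, b, hab⟩ := hdisj
    obtain ⟨i, rfl⟩ := ZMod.intCast_surjective a
    obtain ⟨j, rfl⟩ := ZMod.intCast_surjective b
    rw [hf, hf] at hab
    have htr := hw.mul_translate hu hu₁ huy huz hab
    have hfu : ∀ a, f a * u = f (a + ((j - i : ℤ) : ZMod N)) := by
      intro a
      obtain ⟨k, rfl⟩ := ZMod.intCast_surjective a
      rw [hf, htr, ← hf, Int.cast_add]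
    generalize ((j - i : ℤ) : ZMod N) = d at hfu
    have hd0 : d ≠ 0 := by
      rintro rfl
      have := hfu 0
      simp [hu₁] at this
    have hdd : d + d = 0 := by
      have := hfu (0 + d)
      rw [← hfu, mul_assoc, huu, mul_one] at this
      simpa using (hfinj this).symm
    have hval : N = 2 * d.val := by
      have h₁ : N ∣ d.val + d.val := by
        rw [← ZMod.natCast_eq_zero_iff]
        simpa using hdd
      have h₂ := d.val_lt
      have h₃ : d.val ≠ 0 := by simpa using hd0
      obtain ⟨c, hc⟩ := h₁
      have : c < 2 := by
        by_contra! h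
        have := Nat.mul_le_mul_left N h
        lia
      interval_cases c <;> lia
    have hdv : d = (d.val : ZMod N) := by simp
    generalize d.val = m at hval hdv
    subst hval hdv
    refine ⟨m, by lia, ⟨RelIso.symm ⟨Equiv.ofBijective f ⟨hfinj, fun g => ?_⟩, ?_⟩⟩⟩
    · obtain ⟨i, rfl | rfl⟩ := hsurj g
      · exact ⟨i, hf i⟩
      · exact ⟨i + m, by rw [← hf, hfu]⟩
    · intro a b
      change (cayleyGraph _).Adj (f a) (f b) ↔ _
      rw [mobiusLadder_adj (by lia), hadj, hfn,
        hfu, hfinj.eq_iff, hfinj.eq_iff, hfinj.eq_iff]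
  · left
    push Not at hdisj
    have h2 : ∀ e : ZMod 2, e = 0 ∨ e = 1 := by decide
    have h2' : (1 : ZMod 2) + 1 = 0 := by decide
    refine ⟨N, hN, ⟨RelIso.symm ⟨Equiv.ofBijective
      (fun p : ZMod N × ZMod 2 => if p.2 = 0 then f p.1 else f p.1 * u)
      ⟨fun p q h => ?_, fun g => ?_⟩, ?_⟩⟩⟩
    · obtain ⟨a, e⟩ := p
      obtain ⟨b, e'⟩ := q
      rcases h2 e with rfl | rfl <;> rcases h2 e' with rfl | rfl
      · simpa [hfinj.eq_iff] using h
      · exact absurd (by simpa using h.symm) (hdisj b a)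
      · exact absurd (by simpa using h) (hdisj a b)
      · simpa [hfinj.eq_iff] using h
    · obtain ⟨i, rfl | rfl⟩ := hsurj g
      · exact ⟨(i, 0), by simp [hf]⟩
      · exact ⟨(i, 1), by simp [hf]⟩
    · rintro ⟨a, e⟩ ⟨b, e'⟩
      have hdisj' : ∀ a b, f a ≠ f b * u := fun a b h => hdisj b a h.symm
      change (cayleyGraph _).Adj (if e = 0 then f a else f a * u)
        (if e' = 0 then f b else f b * u) ↔ _
      rw [circularLadder_adj, hadj]
      rcases h2 e with rfl | rfl <;> rcases h2 e' with rfl | rfl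
      · simp [hfn, hfinj.eq_iff, hdisj']
      · simp [hfn, hfinj.eq_iff, hdisj]
      · simp [hfun, hfinj.eq_iff, hdisj', mul_assoc (f a) u u, huu, h2']
      · simp [hfun, hfinj.eq_iff, hdisj, mul_assoc (f a) u u, huu, h2']

theorem mul_comm_of_normal_zpowers {x : G} (hx : x * x = 1)
    (hn : (Subgroup.zpowers x).Normal) (g : G) : x * g = g * x := by
  obtain ⟨k, hk⟩ := Subgroup.mem_zpowers_iff.1 (hn.conj_mem x (Subgroup.mem_zpowers x) g)
  rw [eq_mul_inv_iff_mul_eq] at hk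
  obtain ⟨m, rfl | rfl⟩ := Int.even_or_odd' k
  · rw [zpow_mul, zpow_two, hx, one_zpow, one_mul, left_eq_mul] at hk
    simp [hk]
  · rwa [zpow_add_one, zpow_mul, zpow_two, hx, one_zpow, one_mul] at hk

theorem conj_eq_or_inv_of_normal_zpowers {x t : G} (hp : (orderOf x).Prime)
    (hn : (Subgroup.zpowers x).Normal) (ht : t * t = 1) :
    t * x * t⁻¹ = x ∨ t * x * t⁻¹ = x⁻¹ := by
  obtain ⟨k, hk⟩ := Subgroup.mem_zpowers_iff.1 (hn.conj_mem x (Subgroup.mem_zpowers x) t)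
  have hkk : x ^ (k * k) = x := by
    rw [zpow_mul, hk, conj_zpow, hk]
    rw [inv_eq_of_mul_eq_one_left ht]
    simp only [← mul_assoc, ht, one_mul]
    rw [mul_assoc, ht, mul_one]
  rw [← hk]
  have hd : (orderOf x : ℤ) ∣ (k - 1) * (k + 1) := by
    rw [orderOf_dvd_iff_zpow_eq_one, show (k - 1) * (k + 1) = k * k - 1 by ring, zpow_sub_one, hkk,
      mul_inv_cancel]
  rcases (Nat.prime_iff_prime_int.1 hp).dvd_or_dvd hd with h | h
  · left
    rw [orderOf_dvd_iff_zpow_eq_one, zpow_sub_one, mul_inv_eq_one] at h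
    exact h
  · right
    rw [orderOf_dvd_iff_zpow_eq_one, zpow_add_one] at h
    exact eq_inv_of_mul_eq_one_left h

end CayleyLadder

open CayleyLadder in
/-- Let `G` be a finite group of order at least 4 and `X` an inverse-closed generating
set of `G` of size 3 not containing the identity.  If some `x ∈ X` has prime order and
`⟨x⟩` is normal in `G`, then the cubic connected Cayley graph `Cay(G, X)` is isomorphic
to a circular ladder `CL_n` (`n ≥ 3`) or to a Möbius ladder `M_n` (`n ≥ 2`). -/
theorem cubic_cayley_normal_prime_cyclic_is_closed_ladder
    {G : Type*} [Group G] [Fintype G] [DecidableEq G]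
    (hG : 4 ≤ Fintype.card G)
    (X : Finset G) (h1 : (1 : G) ∉ X) (hinv : ∀ x ∈ X, x⁻¹ ∈ X)
    (hcard : X.card = 3) (hgen : Subgroup.closure (X : Set G) = ⊤)
    (x : G) (hx : x ∈ X) (hxp : (orderOf x).Prime)
    (hxn : (Subgroup.zpowers x).Normal) :
    (∃ n, 3 ≤ n ∧ Nonempty (cayleyGraph (X : Set G) ≃g circularLadder n)) ∨
    (∃ n, 2 ≤ n ∧ Nonempty (cayleyGraph (X : Set G) ≃g mobiusLadder n)) := by
  have hx1 : x ≠ 1 := ne_of_mem_of_not_mem hx h1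
  by_cases hxx : x * x = 1
  · obtain ⟨y, z, hyz, hX⟩ := Finset.card_eq_two.1
      (show (X.erase x).card = 2 by rw [Finset.card_erase_of_mem hx, hcard])
    have hxyz : x ∉ ({y, z} : Finset G) := hX ▸ Finset.notMem_erase x X
    rw [← Finset.insert_erase hx, hX] at h1 hinv hgen ⊢
    push_cast at hgen ⊢
    simp only [Finset.mem_insert, Finset.mem_singleton, not_or, forall_eq_or_imp, forall_eq]
      at h1 hinv hxyz
    have hinv' : s(y⁻¹, z⁻¹) = s(y, z) := by
      have hxi := inv_eq_of_mul_eq_one_left hxx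
      have hyi := inv_inv y
      have hzi := inv_inv z
      rw [Sym2.eq_iff]
      grind
    refine exists_iso_ladder hyz (Ne.symm h1.2.1) (Ne.symm h1.2.2) hx1 hxyz.1 hxyz.2 hxx hinv' ?_
      hgen
    rw [mul_comm_of_normal_zpowers hxx hxn, mul_comm_of_normal_zpowers hxx hxn]
  · have hxi : x ≠ x⁻¹ := mt eq_inv_iff_mul_eq_one.1 hxx
    have hx' : x⁻¹ ∈ X.erase x := Finset.mem_erase.2 ⟨hxi.symm, hinv x hx⟩
    obtain ⟨t, hX⟩ := Finset.card_eq_one.1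
      (show ((X.erase x).erase x⁻¹).card = 1 by
        rw [Finset.card_erase_of_mem hx', Finset.card_erase_of_mem hx, hcard])
    have ht : t ∈ (X.erase x).erase x⁻¹ := by simp [hX]
    simp only [Finset.mem_erase] at ht
    obtain ⟨htx', htx, htX⟩ := ht
    have ht1 : t ≠ 1 := ne_of_mem_of_not_mem htX h1
    have hXt : (X : Set G) = {t, x, x⁻¹} := by
      rw [← Finset.insert_erase hx, ← Finset.insert_erase hx', hX]
      push_cast
      grind
    have htt : t * t = 1 := by
      have hti : t⁻¹ ∈ (X : Set G) := hinv t htX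
      rw [hXt] at hti
      rcases hti with h | h | h
      · exact inv_eq_iff_mul_eq_one.1 h
      · exact absurd (inv_eq_iff_eq_inv.1 h) htx'
      · exact absurd (inv_inj.1 h) htx
    rw [hXt] at hgen ⊢
    refine exists_iso_ladder hxi hx1 (inv_ne_one.2 hx1) ht1 htx htx' htt
      (by rw [inv_inv, Sym2.eq_swap]) ?_ hgen
    rcases conj_eq_or_inv_of_normal_zpowers hxp hxn htt with h | h
    · have h' : t * x⁻¹ = x⁻¹ * t := by rw [← mul_inv_eq_iff_eq_mul, ← conj_inv, h]
      rw [h', mul_inv_eq_iff_eq_mul.1 h]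
    · have h' : t * x⁻¹ = x * t := by rw [← mul_inv_eq_iff_eq_mul, ← conj_inv, h, inv_inv]
      rw [h', mul_inv_eq_iff_eq_mul.1 h, Sym2.eq_swap]
end

section
/- Let G be a finite group and X ⊆ G \ {1} with X = X⁻¹ and |X| ≥ 5. Suppose X contains an involution z and four further pairwise distinct elements u₁, u₂, v₁, v₂, all distinct from z, such that {u₁,u₂} and {v₁,v₂} are each inverse-closed, and such that the cubic Cayley graphs Cay(⟨u₁,u₂,z⟩, {u₁,u₂,z}) and Cay(⟨v₁,v₂,z⟩, {v₁,v₂,z}) are both closed ladders with z as their rung involution. Then Cay(G,X) admits a nowhere-zero 3-flow. -/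
/-- The Cayley graph `Cay(H, S)` is a closed ladder with `z` as its rung involution:
there is a graph isomorphism onto a circular ladder `CL_n` (`n ≥ 3`) or a Möbius ladder
`M_n` (`n ≥ 2`) carrying the set of edges `{h, hz}` (`h ∈ H`) exactly onto the set of
rungs of that ladder. -/
def IsClosedLadderWithRungInvolution {H : Type*} [Group H] (S : Set H) (z : H) : Prop :=
  (∃ n, 3 ≤ n ∧ ∃ φ : cayleyGraph S ≃g circularLadder n,
      ∀ g h : H, (cayleyGraph S).Adj g h → ((g⁻¹ * h = z) ↔ (φ g).1 = (φ h).1)) ∨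
  (∃ n, 2 ≤ n ∧ ∃ φ : cayleyGraph S ≃g mobiusLadder n,
      ∀ g h : H, (cayleyGraph S).Adj g h → ((g⁻¹ * h = z) ↔ φ h = φ g + (n : ZMod (2 * n))))

open Finset in
/-- Summing over `ZMod m` is summing over the residues `0, …, m - 1`. -/
theorem ZMod.sum_range_natCast {M : Type*} [AddCommMonoid M] (m : ℕ) [NeZero m]
    (f : ZMod m → M) : ∑ k ∈ range m, f (k : ZMod m) = ∑ x, f x := by
  refine sum_nbij' (fun k => (k : ZMod m)) ZMod.val ?_ ?_ ?_ ?_ ?_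
  · simp
  · intro x _
    simpa using ZMod.val_lt x
  · intro k hk
    exact ZMod.val_cast_of_lt (by simpa using hk)
  · simp
  · simp

open Finset in
theorem ZMod.exists_potential (m : ℕ) [NeZero m] (r : ZMod m → ZMod 2) (hr : ∑ x, r x = 0) :
    ∃ s : ZMod m → ZMod 2, ∀ i, s (i + 1) = s i + r (i + 1) := by
  refine ⟨fun i => ∑ k ∈ range (i.val + 1), r (k : ZMod m), fun i => ?_⟩
  have hi : ((i.val : ℕ) : ZMod m) = i := ZMod.natCast_zmod_val i
  by_cases h : i.val + 1 = m
  · have h0 : i + 1 = 0 := by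
      rw [← hi]
      exact_mod_cast (congrArg (Nat.cast : ℕ → ZMod m) h).trans (ZMod.natCast_self m)
    simp only [h0, h, ZMod.sum_range_natCast, hr]
    simp
  · have hlt : i.val + 1 < m := lt_of_le_of_ne (ZMod.val_lt i) h
    have hv : (i + 1).val = i.val + 1 := by
      conv_lhs => rw [← hi]
      exact_mod_cast ZMod.val_cast_of_lt hlt
    simp only [hv]
    rw [sum_range_succ _ (i.val + 1)]
    push_cast
    rw [hi]

/-- `σ` is the successor permutation along the rails of a ladder and `τ` exchanges the ends of
its rungs. Every set `R` of rungs with `|R| ≡ t (mod 4)`, counted by their ends, is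
the set of rungs at which some two-valued rail labelling, opposite on the two rails, changes. -/
def HasRungSigns {V : Type*} (σ : Equiv.Perm V) (τ : V → V) (t : ℕ) : Prop :=
  ∀ R : V → Prop, (∀ x, R (τ x) ↔ R x) → Nat.card {x // R x} % 4 = t →
    ∃ s : V → ZMod 2, (∀ x, s (τ x) = s x + 1) ∧
      ∀ x, (R (σ x) → s (σ x) = s x + 1) ∧ (¬ R (σ x) → s (σ x) = s x)

theorem HasRungSigns.congr {V W : Type*} {σ : Equiv.Perm V} {τ : V → V} {t : ℕ}
    (h : HasRungSigns σ τ t) (φ : W ≃ V) (τ' : W → W) (hτ : ∀ x, φ (τ' x) = τ (φ x)) :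
    HasRungSigns ((φ.trans σ).trans φ.symm) τ' t := by
  intro R hR hcard
  obtain ⟨s, hs, hs'⟩ := h (fun x => R (φ.symm x))
    (fun x => by
      rw [← hR (φ.symm x)]
      have : φ.symm (τ x) = τ' (φ.symm x) := by
        rw [Equiv.symm_apply_eq, hτ, Equiv.apply_symm_apply]
      rw [this])
    (by
      rw [← hcard]
      congr 1
      exact Nat.card_congr (φ.symm.subtypeEquiv (fun _ => Iff.rfl)))
  exact ⟨fun x => s (φ x), fun x => by simp only [hτ, hs], fun x => by simpa using hs' (φ x)⟩

open Finset Classical in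
theorem natCard_subtype_eq_sum {V : Type*} [Fintype V] (R : V → Prop) :
    Nat.card {x // R x} = ∑ x, if R x then 1 else 0 := by
  rw [Nat.card_eq_fintype_card, Fintype.card_subtype, card_filter]

theorem ZMod.two_eq_zero_or_one (a : ZMod 2) : a = 0 ∨ a = 1 := by
  revert a; decide

open Finset Classical in
theorem circularLadder_hasRungSigns (n : ℕ) [NeZero n] :
    HasRungSigns ((Equiv.addRight (1 : ZMod n)).prodCongr (Equiv.refl (ZMod 2)))
      (fun p => (p.1, p.2 + 1)) 0 := by
  intro R hR hcard
  have hR' : ∀ i ε, R (i, ε) ↔ R (i, 0) := by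
    intro i ε
    rcases ZMod.two_eq_zero_or_one ε with rfl | rfl
    · rfl
    · simpa using hR (i, 0)
  rw [natCard_subtype_eq_sum, Fintype.sum_prod_type] at hcard
  simp only [hR', sum_const, card_univ, ZMod.card, smul_eq_mul, ← mul_sum] at hcard
  obtain ⟨s, hs⟩ := ZMod.exists_potential n (fun i => if R (i, 0) then 1 else 0) (by
    have : ((∑ i : ZMod n, if R (i, 0) then 1 else 0 : ℕ) : ZMod 2) = 0 := by
      rw [ZMod.natCast_eq_zero_iff]
      omega
    simpa using this)
  refine ⟨fun p => s p.1 + p.2, fun p => by ring, fun p => ?_⟩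
  obtain ⟨i, ε⟩ := p
  simp only [Equiv.prodCongr_apply, Prod.map, Equiv.coe_addRight, Equiv.refl_apply]
  rw [hR', hs]
  constructor
  · intro h
    rw [if_pos h]; ring
  · intro h
    rw [if_neg h]; ring

open Finset Classical in
theorem mobiusLadder_hasRungSigns (n : ℕ) [NeZero n] :
    HasRungSigns (Equiv.addRight (1 : ZMod (2 * n))) (fun i => i + (n : ZMod (2 * n))) 2 := by
  intro R hR hcard
  have : NeZero (2 * n) := ⟨mul_ne_zero two_ne_zero (NeZero.ne n)⟩
  rw [natCard_subtype_eq_sum] at hcard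
  have hhalf : ∑ i, (if R i then 1 else 0) =
      2 * ∑ k ∈ range n, if R ((k : ZMod (2 * n)) + 1) then 1 else 0 := by
    rw [← Equiv.sum_comp (Equiv.addRight (1 : ZMod (2 * n))),
      ← ZMod.sum_range_natCast (2 * n)]
    simp only [Equiv.coe_addRight]
    have hadd : ∀ g : ℕ → ℕ, ∑ k ∈ range (2 * n), g k =
        ∑ k ∈ range n, g k + ∑ k ∈ range n, g (n + k) := fun g => by
      rw [two_mul, sum_range_add]
    rw [hadd, two_mul (∑ k ∈ range n, _)]
    congr 1
    refine sum_congr rfl fun k _ => ?_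
    have h : ((n + k : ℕ) : ZMod (2 * n)) + 1 = ((k : ZMod (2 * n)) + 1) + n := by
      push_cast; ring
    exact if_congr (by rw [h]; exact hR _) rfl rfl
  obtain ⟨s, hs⟩ := ZMod.exists_potential (2 * n) (fun i => if R i then 1 else 0) (by
    have : ((∑ i : ZMod (2 * n), if R i then 1 else 0 : ℕ) : ZMod 2) = 0 := by
      rw [ZMod.natCast_eq_zero_iff]
      omega
    simpa using this)
  have hsum : ∀ m : ℕ, s (m : ZMod (2 * n)) =
      s 0 + ((∑ k ∈ range m, if R ((k : ZMod (2 * n)) + 1) then 1 else 0 : ℕ) : ZMod 2) := by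
    intro m
    induction m with
    | zero => simp
    | succ m ih =>
      rw [sum_range_succ]
      push_cast
      rw [hs, ih]
      push_cast
      ring
  have hopp : ∀ m : ℕ, s ((m : ZMod (2 * n)) + n) = s m + 1 := by
    intro m
    induction m with
    | zero =>
      have hodd : ((∑ k ∈ range n, if R ((k : ZMod (2 * n)) + 1) then 1 else 0 : ℕ) : ZMod 2)
          = 1 := by
        rw [ZMod.natCast_eq_one_iff_odd, Nat.odd_iff]
        omega
      have hn := hsum n
      rw [hodd] at hn
      simpa using hn
    | succ m ih =>
      have h : ((m + 1 : ℕ) : ZMod (2 * n)) + n = (m + n) + 1 := by push_cast; ring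
      have h' : (m + n : ZMod (2 * n)) + 1 = (m + 1) + n := by ring
      rw [h, hs, ih, h']
      push_cast
      rw [hs, hR]
      ring
  refine ⟨s, fun i => ?_, fun i => ?_⟩
  · simpa using hopp i.val
  · simp only [Equiv.coe_addRight]
    rw [hs]
    constructor
    · intro h
      rw [if_pos h]
    · intro h
      rw [if_neg h, add_zero]
theorem cayleyGraph_adj {G : Type*} [Group G] {X : Set G} (h1 : (1 : G) ∉ X)
    (hinv : ∀ x ∈ X, x⁻¹ ∈ X) (g h : G) : (cayleyGraph X).Adj g h ↔ g⁻¹ * h ∈ X := by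
  rw [cayleyGraph, SimpleGraph.fromRel_adj]
  constructor
  · rintro ⟨-, h | h⟩
    · exact h
    · simpa using hinv _ h
  · intro h
    refine ⟨?_, Or.inl h⟩
    rintro rfl
    exact h1 (by simpa using h)

theorem circularLadder_adj {n : ℕ} (p q : ZMod n × ZMod 2) : (circularLadder n).Adj p q ↔
    p ≠ q ∧ (((p.2 = q.2 ∧ q.1 = p.1 + 1) ∨ (p.1 = q.1 ∧ p.2 ≠ q.2)) ∨
      ((q.2 = p.2 ∧ p.1 = q.1 + 1) ∨ (q.1 = p.1 ∧ q.2 ≠ p.2))) :=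
  SimpleGraph.fromRel_adj _ _ _

theorem mobiusLadder_adj {n : ℕ} (i j : ZMod (2 * n)) : (mobiusLadder n).Adj i j ↔
    i ≠ j ∧ ((j = i + 1 ∨ j = i + (n : ZMod (2 * n))) ∨
      (i = j + 1 ∨ i = j + (n : ZMod (2 * n)))) :=
  SimpleGraph.fromRel_adj _ _ _

/-- The rails of a closed ladder carry a successor permutation, compatible with the rungs. -/
theorem IsClosedLadderWithRungInvolution.exists_perm {H : Type*} [Group H] {S : Set H} {z : H}
    (hL : IsClosedLadderWithRungInvolution S z) (h1 : (1 : H) ∉ S)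
    (hinv : ∀ x ∈ S, x⁻¹ ∈ S) (hz : z ∈ S) :
    ∃ (σ : Equiv.Perm H) (t : ℕ), (t = 0 ∨ t = 2) ∧ (∀ x, σ (x * z) = σ x * z) ∧
      (∀ x y, (x⁻¹ * y ∈ S ∧ x⁻¹ * y ≠ z) ↔ (y = σ x ∨ x = σ y)) ∧ (∀ x, σ (σ x) ≠ x) ∧
      HasRungSigns σ (fun x => x * z) t := by
  have hadj := cayleyGraph_adj h1 hinv
  have hadjz : ∀ x, (cayleyGraph S).Adj x (x * z) := fun x => by simpa [hadj] using hz
  rcases hL with ⟨n, hn, φ, hφ⟩ | ⟨n, hn, φ, hφ⟩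
  · have : NeZero n := ⟨by omega⟩
    have one_ne : (1 : ZMod n) ≠ 0 := by
      intro h
      have := (ZMod.natCast_eq_zero_iff 1 n).1 (by simpa using h)
      exact absurd (Nat.le_of_dvd one_pos this) (by omega)
    have two_ne : (1 + 1 : ZMod n) ≠ 0 := by
      intro h
      have := (ZMod.natCast_eq_zero_iff 2 n).1 (by rw [← h]; norm_num)
      exact absurd (Nat.le_of_dvd two_pos this) (by omega)
    have hτ : ∀ x, φ (x * z) = ((φ x).1, (φ x).2 + 1) := by
      intro x
      have ha := hadjz x
      have h₁ := (hφ _ _ ha).1 (by simp)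
      have h₂ : (φ (x * z)).2 ≠ (φ x).2 := by
        intro h
        exact (φ.map_rel_iff.2 ha).ne (Prod.ext h₁ h.symm)
      refine Prod.ext h₁.symm ?_
      change (φ (x * z)).2 = (φ x).2 + 1
      generalize (φ (x * z)).2 = a at h₂ ⊢
      generalize (φ x).2 = b at h₂ ⊢
      clear * - h₂
      revert a b
      decide
    have hσ : ∀ x, φ (((φ.toEquiv.trans ((Equiv.addRight (1 : ZMod n)).prodCongr
        (Equiv.refl (ZMod 2)))).trans φ.toEquiv.symm) x) = ((φ x).1 + 1, (φ x).2) :=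
      fun x => φ.apply_symm_apply _
    refine ⟨_, 0, Or.inl rfl, ?_, ?_, ?_,
      (circularLadder_hasRungSigns n).congr φ.toEquiv (fun x => x * z) hτ⟩
    · intro x
      apply φ.injective
      rw [hτ, hσ, hσ, hτ]
    · intro x y
      have key : (y = φ.symm ((φ x).1 + 1, (φ x).2) ∨ x = φ.symm ((φ y).1 + 1, (φ y).2)) ↔
          (φ y = ((φ x).1 + 1, (φ x).2) ∨ φ x = ((φ y).1 + 1, (φ y).2)) := by
        rw [RelIso.eq_symm_apply, RelIso.eq_symm_apply]
      refine Iff.trans ?_ key.symm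
      rw [← hadj]
      have hc : (cayleyGraph S).Adj x y ↔ (circularLadder n).Adj (φ x) (φ y) :=
        φ.map_rel_iff.symm
      constructor
      · rintro ⟨ha, hne⟩
        rw [Ne, hφ _ _ ha] at hne
        rw [hc, circularLadder_adj] at ha
        rcases ha.2 with (h | h) | (h | h)
        · exact Or.inl (Prod.ext h.2 h.1.symm)
        · exact absurd h.1 hne
        · exact Or.inr (Prod.ext h.2 h.1.symm)
        · exact absurd h.1.symm hne
      · intro h
        have hne : (φ x).1 ≠ (φ y).1 := by
          rcases h with h | h <;> rw [h] <;> simpa using one_ne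
        have ha : (cayleyGraph S).Adj x y := by
          rw [hc, circularLadder_adj]
          refine ⟨fun h' => hne (congrArg Prod.fst h'), ?_⟩
          rcases h with h | h
          · exact Or.inl (Or.inl ⟨by rw [h], by rw [h]⟩)
          · exact Or.inr (Or.inl ⟨by rw [h], by rw [h]⟩)
        exact ⟨ha, by rwa [Ne, hφ _ _ ha]⟩
    · intro x h
      have h' := congrArg (fun y => (φ y).1) h
      simp only [hσ, add_assoc, add_eq_left] at h'
      exact two_ne h'
  · have : NeZero n := ⟨by omega⟩
    have two_ne : (1 + 1 : ZMod (2 * n)) ≠ 0 := by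
      intro h
      have := (ZMod.natCast_eq_zero_iff 2 (2 * n)).1 (by rw [← h]; norm_num)
      exact absurd (Nat.le_of_dvd two_pos this) (by omega)
    have one_ne : (1 : ZMod (2 * n)) ≠ n := by
      intro h
      have := (ZMod.natCast_eq_natCast_iff' 1 n (2 * n)).1 (by simpa using h)
      rw [Nat.mod_eq_of_lt (by omega), Nat.mod_eq_of_lt (by omega)] at this
      omega
    have hnn : (n : ZMod (2 * n)) + n = 0 := by
      have := ZMod.natCast_self (2 * n)
      push_cast at this
      rw [← this]; ring
    have hτ : ∀ x, φ (x * z) = φ x + n := fun x => (hφ _ _ (hadjz x)).1 (by simp)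
    have hσ : ∀ x, φ (((φ.toEquiv.trans (Equiv.addRight (1 : ZMod (2 * n)))).trans
        φ.toEquiv.symm) x) = φ x + 1 :=
      fun x => φ.apply_symm_apply _
    refine ⟨_, 2, Or.inr rfl, ?_, ?_, ?_,
      (mobiusLadder_hasRungSigns n).congr φ.toEquiv (fun x => x * z) hτ⟩
    · intro x
      apply φ.injective
      rw [hτ, hσ, hσ, hτ]
      ring
    · intro x y
      have key : (y = φ.symm (φ x + 1) ∨ x = φ.symm (φ y + 1)) ↔
          (φ y = φ x + 1 ∨ φ x = φ y + 1) := by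
        rw [RelIso.eq_symm_apply, RelIso.eq_symm_apply]
      refine Iff.trans ?_ key.symm
      rw [← hadj]
      have hc : (cayleyGraph S).Adj x y ↔ (mobiusLadder n).Adj (φ x) (φ y) :=
        φ.map_rel_iff.symm
      constructor
      · rintro ⟨ha, hne⟩
        rw [Ne, hφ _ _ ha] at hne
        rw [hc, mobiusLadder_adj] at ha
        rcases ha.2 with (h | h) | (h | h)
        · exact Or.inl h
        · exact absurd h hne
        · exact Or.inr h
        · exact absurd (by rw [h, add_assoc, hnn, add_zero]) hne
      · intro h
        have hne : φ y ≠ φ x + n := by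
          rcases h with h | h <;> rw [h]
          · simpa using one_ne
          · intro h'
            rw [add_assoc, left_eq_add] at h'
            apply one_ne
            have h'' : (1 : ZMod (2 * n)) = (1 + n) - (n + n) + n := by ring
            rw [h'', h', hnn]
            simp
        have ha : (cayleyGraph S).Adj x y := by
          rw [hc, mobiusLadder_adj]
          refine ⟨fun h' => ?_, h.imp Or.inl Or.inl⟩
          rw [h'] at h
          apply two_ne
          rw [or_self, left_eq_add] at h
          rw [h, add_zero]
        exact ⟨ha, by rwa [Ne, hφ _ _ ha]⟩
    · intro x h
      have heq := congrArg φ h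
      simp only [hσ, add_assoc, add_eq_left] at heq
      exact two_ne heq

/-- The identification of a group with the product of a subgroup and its left cosets, by
means of coset representatives. -/
noncomputable def Subgroup.cosetProdEquiv {G : Type*} [Group G] (H : Subgroup G) :
    G ≃ (G ⧸ H) × H where
  toFun g := (g, ⟨(g : G ⧸ H).out⁻¹ * g, QuotientGroup.eq.1 (QuotientGroup.out_eq' _)⟩)
  invFun p := p.1.out * p.2
  left_inv g := by simp
  right_inv p := by
    have h : ((p.1.out * p.2 : G) : G ⧸ H) = p.1 := by
      rw [QuotientGroup.mk_mul_of_mem _ p.2.2, QuotientGroup.out_eq']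
    refine Prod.ext h (Subtype.ext ?_)
    simp [h]

theorem Subgroup.cosetProdEquiv_mul {G : Type*} [Group G] (H : Subgroup G) (g : G) (h : H) :
    H.cosetProdEquiv (g * h) = ((H.cosetProdEquiv g).1, (H.cosetProdEquiv g).2 * h) := by
  have e : ((g * h : G) : G ⧸ H) = g := QuotientGroup.mk_mul_of_mem _ h.2
  refine Prod.ext e (Subtype.ext ?_)
  simp [Subgroup.cosetProdEquiv, e, mul_assoc]

/-- The rails of the translates of a closed ladder `Cay(⟨u₁, u₂, z⟩, {u₁, u₂, z})` over all of
`G`. -/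
theorem exists_perm_of_isClosedLadder {G : Type*} [Group G] {u₁ u₂ z : G} (H : Subgroup G)
    (hu₁ : u₁ ∈ H) (hu₂ : u₂ ∈ H) (hz : z ∈ H) (h₁ : u₁ ≠ 1) (h₂ : u₂ ≠ 1) (hz1 : z ≠ 1)
    (h₁z : u₁ ≠ z) (h₂z : u₂ ≠ z) (hu₁inv : u₁⁻¹ = u₁ ∨ u₁⁻¹ = u₂)
    (hu₂inv : u₂⁻¹ = u₁ ∨ u₂⁻¹ = u₂) (hzinv : z⁻¹ = z)
    (hL : IsClosedLadderWithRungInvolution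
      ((fun x : H => (x : G)) ⁻¹' ({u₁, u₂, z} : Set G)) ⟨z, hz⟩) :
    ∃ (σ : Equiv.Perm G) (t : ℕ), (t = 0 ∨ t = 2) ∧ (∀ x, σ (x * z) = σ x * z) ∧
      (∀ x y, (x⁻¹ * y = u₁ ∨ x⁻¹ * y = u₂) ↔ (y = σ x ∨ x = σ y)) ∧ (∀ x, σ (σ x) ≠ x) ∧
      ∀ R : G → Prop, (∀ x, R (x * z) ↔ R x) →
        (∀ c : G ⧸ H, Nat.card {x : G // (x : G ⧸ H) = c ∧ R x} % 4 = t) →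
        ∃ s : G → ZMod 2, (∀ x, s (x * z) = s x + 1) ∧
          ∀ x, (R (σ x) → s (σ x) = s x + 1) ∧ (¬ R (σ x) → s (σ x) = s x) := by
  obtain ⟨σ, t, ht, hσz, hσ, hσ2, hs⟩ := hL.exists_perm
    (by simp [h₁.symm, h₂.symm, hz1.symm])
    (by
      intro x
      simp only [Set.mem_preimage, Set.mem_insert_iff, Set.mem_singleton_iff, Subgroup.coe_inv]
      rintro (hx | hx | hx) <;> rw [hx]
      · rcases hu₁inv with h | h <;> simp [h]
      · rcases hu₂inv with h | h <;> simp [h]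
      · simp [hzinv]) (by simp)
  set e := H.cosetProdEquiv with he
  have emul : ∀ g (h : H), e (g * h) = ((e g).1, (e g).2 * h) := H.cosetProdEquiv_mul
  have emk : ∀ g, (e g).1 = (g : G ⧸ H) := fun g => rfl
  have emulz : ∀ g, e (g * z) = ((e g).1, (e g).2 * ⟨z, hz⟩) := fun g => emul g ⟨z, hz⟩
  have esymm : ∀ c h, e.symm (c, h * ⟨z, hz⟩) = e.symm (c, h) * z := by
    intro c h
    rw [Equiv.symm_apply_eq, emulz]
    simp
  let σ' : Equiv.Perm G := (e.trans ((Equiv.refl _).prodCongr σ)).trans e.symm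
  have hσ' : ∀ x, e (σ' x) = ((e x).1, σ (e x).2) := fun x => e.apply_symm_apply _
  have hdiff : ∀ x y : G, x⁻¹ * y ∈ H →
      (e x).1 = (e y).1 ∧ x⁻¹ * y = (((e x).2⁻¹ * (e y).2 : H) : G) := by
    intro x y h
    have hy : y = x * (⟨x⁻¹ * y, h⟩ : H) := by simp
    have hey := emul x ⟨x⁻¹ * y, h⟩
    rw [← hy] at hey
    rw [hey]
    simp
  have hdiff' : ∀ x y : G, (e x).1 = (e y).1 → x⁻¹ * y ∈ H := fun x y h =>
    QuotientGroup.eq.1 h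
  have hS : ∀ h : H, (h ∈ ((fun x : H => (x : G)) ⁻¹' ({u₁, u₂, z} : Set G)) ∧ h ≠ ⟨z, hz⟩) ↔
      ((h : G) = u₁ ∨ (h : G) = u₂) := by
    intro h
    simp only [Set.mem_preimage, Set.mem_insert_iff, Set.mem_singleton_iff, Ne, Subtype.ext_iff]
    constructor
    · tauto
    · rintro (h | h) <;> simp [h, h₁z, h₂z]
  refine ⟨σ', t, ht, ?_, ?_, ?_, ?_⟩
  · intro x
    apply e.injective
    rw [hσ', emulz, emulz, hσ', hσz]
  · intro x y
    rw [← e.injective.eq_iff (a := y), ← e.injective.eq_iff (a := x), hσ', hσ', Prod.ext_iff,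
      Prod.ext_iff]
    simp only
    constructor
    · intro h
      obtain ⟨h₁, h₂⟩ := hdiff x y (by rcases h with h | h <;> rw [h] <;> assumption)
      rw [h₂, ← hS, hσ] at h
      exact h.imp (fun h => ⟨h₁.symm, h⟩) (fun h => ⟨h₁, h⟩)
    · intro h
      have hm : (e x).1 = (e y).1 := by rcases h with h | h <;> simp [h.1]
      rw [(hdiff x y (hdiff' x y hm)).2, ← hS, hσ]
      exact h.imp And.right And.right
  · intro x h
    have h' := congrArg (fun y => (e y).2) h
    simp only [hσ'] at h'
    exact hσ2 _ h'
  · intro R hR hcard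
    have : ∀ c, ∃ s : H → ZMod 2, (∀ x, s (x * ⟨z, hz⟩) = s x + 1) ∧
        ∀ x, (R (e.symm (c, σ x)) → s (σ x) = s x + 1) ∧
          (¬ R (e.symm (c, σ x)) → s (σ x) = s x) := by
      intro c
      refine hs (fun h => R (e.symm (c, h))) (fun h => ?_) ?_
      · simp only [esymm]
        exact hR _
      · rw [← hcard c]
        congr 1
        refine Nat.card_congr ⟨fun h => ⟨e.symm (c, h.1), ?_, h.2⟩,
          fun g => ⟨(e g.1).2, ?_⟩, ?_, ?_⟩
        · rw [← emk, Equiv.apply_symm_apply]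
        · have h : (c, (e g.1).2) = e g.1 := Prod.ext (g.2.1.symm.trans (emk _).symm) rfl
          rw [h, Equiv.symm_apply_apply]
          exact g.2.2
        · intro h
          simp
        · intro g
          have h : (c, (e g.1).2) = e g.1 := Prod.ext (g.2.1.symm.trans (emk _).symm) rfl
          apply Subtype.ext
          simp only
          rw [h, Equiv.symm_apply_apply]
    choose s hs₁ hs₂ using this
    refine ⟨fun x => s (e x).1 (e x).2, fun x => ?_, fun x => ?_⟩
    · simp only [emulz, hs₁]
    · simp only [hσ']
      exact hs₂ _ _

open Finset Classical in
/-- Every left coset of `H` and of `K` can be assigned one of the pairs `{x, xz}` it contains, so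
that no pair is used twice. -/
theorem exists_disjoint_rung_systems {G : Type*} [Group G] [Fintype G] (H K : Subgroup G)
    {z u v : G} (hz2 : z * z = 1) (hzH : z ∈ H) (hzK : z ∈ K) (hu : u ∈ H) (hv : v ∈ K)
    (hu1 : u ≠ 1) (huz : u ≠ z) (hv1 : v ≠ 1) (hvz : v ≠ z) :
    ∃ (a : G ⧸ H → G) (b : G ⧸ K → G), (∀ c, (a c : G ⧸ H) = c) ∧ (∀ d, (b d : G ⧸ K) = d) ∧
      ∀ c d, b d ≠ a c ∧ b d ≠ a c * z := by
  let pair : G → Finset G := fun x => {x, x * z}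
  have hpair : ∀ x y, pair x = pair y → y = x ∨ y = x * z := by
    intro x y h
    have : y ∈ pair x := by rw [h]; simp [pair]
    simpa [pair] using this
  have hpair' : ∀ x, pair (x * z) = pair x := by
    intro x
    simp only [pair, mul_assoc, hz2, mul_one]
    exact pair_comm _ _
  let t : (G ⧸ H) ⊕ (G ⧸ K) → Finset (Finset G) := Sum.elim
    (fun c => (univ.filter fun x : G => (x : G ⧸ H) = c).image pair)
    (fun d => (univ.filter fun x : G => (x : G ⧸ K) = d).image pair)
  have htH : ∀ c e, e ∈ t (Sum.inl c) ↔ ∃ x : G, (x : G ⧸ H) = c ∧ pair x = e := by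
    intro c e; simp [t]
  have htK : ∀ d e, e ∈ t (Sum.inr d) ↔ ∃ x : G, (x : G ⧸ K) = d ∧ pair x = e := by
    intro d e; simp [t]
  have hne : ∀ x w : G, w ≠ 1 → w ≠ z → pair x ≠ pair (x * w) := by
    intro x w h1 hz h
    rcases hpair _ _ h with h | h
    · exact h1 (by simpa using h)
    · exact hz (by simpa using h)
  have htwo : ∀ i, 2 ≤ (t i).card := by
    intro i
    rw [Nat.succ_le_iff, one_lt_card]
    rcases i with c | d
    · obtain ⟨x, rfl⟩ := QuotientGroup.mk_surjective c
      exact ⟨pair x, (htH _ _).2 ⟨x, rfl, rfl⟩, pair (x * u),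
        (htH _ _).2 ⟨x * u, QuotientGroup.mk_mul_of_mem _ hu, rfl⟩, hne x u hu1 huz⟩
    · obtain ⟨x, rfl⟩ := QuotientGroup.mk_surjective d
      exact ⟨pair x, (htK _ _).2 ⟨x, rfl, rfl⟩, pair (x * v),
        (htK _ _).2 ⟨x * v, QuotientGroup.mk_mul_of_mem _ hv, rfl⟩, hne x v hv1 hvz⟩
  have huniq : ∀ (L : Subgroup G), z ∈ L → ∀ x y, pair x = pair y → (x : G ⧸ L) = y := by
    intro L hL x y h
    rcases hpair _ _ h with rfl | rfl
    · rfl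
    · exact (QuotientGroup.mk_mul_of_mem _ hL).symm
  obtain ⟨f, hf, hft⟩ := (all_card_le_biUnion_card_iff_exists_injective t).1 (by
    intro S
    have := card_mul_le_card_mul (s := S) (t := S.biUnion t) (fun i e => e ∈ t i)
      (m := 2) (n := 2) (fun i hi => ?_) (fun e he => ?_)
    · omega
    · refine (htwo i).trans (card_le_card fun e he => ?_)
      rw [mem_bipartiteAbove]
      exact ⟨mem_biUnion.2 ⟨i, hi, he⟩, he⟩
    · have hx : ∃ x, pair x = e := by
        obtain ⟨i, -, hi⟩ := mem_biUnion.1 he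
        rcases i with c | d
        · exact ((htH _ _).1 hi).imp fun _ h => h.2
        · exact ((htK _ _).1 hi).imp fun _ h => h.2
      obtain ⟨x, rfl⟩ := hx
      refine (card_le_card (t := {Sum.inl (x : G ⧸ H), Sum.inr (x : G ⧸ K)}) ?_).trans card_le_two
      intro i hi
      rw [mem_bipartiteBelow] at hi
      rcases i with c | d
      · obtain ⟨y, rfl, hy⟩ := (htH _ _).1 hi.2
        simp [huniq H hzH _ _ hy]
      · obtain ⟨y, rfl, hy⟩ := (htK _ _).1 hi.2
        simp [huniq K hzK _ _ hy])
  choose a ha ha' using fun c => (htH _ _).1 (hft (Sum.inl c))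
  choose b hb hb' using fun d => (htK _ _).1 (hft (Sum.inr d))
  have hab : ∀ c d, pair (b d) ≠ pair (a c) := by
    intro c d h
    rw [ha', hb'] at h
    exact absurd (hf h) (by simp)
  exact ⟨a, b, ha, hb, fun c d => ⟨fun h => hab c d (by rw [h]),
    fun h => hab c d (by rw [h, hpair'])⟩⟩

open Finset Classical in
theorem natCard_mod_two_of_involution {G : Type*} [Group G] [Fintype G] {z : G}
    (hz2 : z * z = 1) (hz1 : z ≠ 1) (P : G → Prop) (hP : ∀ x, P (x * z) ↔ P x) :
    Nat.card {x // P x} % 2 = 0 := by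
  rw [Nat.card_eq_fintype_card, Fintype.card_subtype]
  have h : ∑ x ∈ ({x | P x} : Finset G), (1 : ZMod 2) = 0 :=
    sum_involution (fun x _ => x * z) (fun _ _ => by decide) (fun x _ _ => by simpa using hz1)
      (fun x hx => by simpa [hP] using hx) (fun x _ => by simp [mul_assoc, hz2])
  rw [sum_const, nsmul_one, ZMod.natCast_eq_zero_iff] at h
  omega

open Finset Classical in
theorem natCard_eq_add_two {G : Type*} [Group G] [Fintype G] {z a : G}
    (hz1 : z ≠ 1) (P Q : G → Prop) (ha : P a) (haz : P (a * z))
    (hQ : ∀ x, Q x ↔ P x ∧ x ≠ a ∧ x ≠ a * z) :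
    Nat.card {x // P x} = Nat.card {x // Q x} + 2 := by
  simp only [Nat.card_eq_fintype_card, Fintype.card_subtype]
  have h : univ.filter P = univ.filter Q ∪ {a, a * z} := by
    ext x
    simp only [mem_filter, mem_univ, true_and, mem_union, mem_insert, mem_singleton, hQ]
    constructor
    · tauto
    · rintro (h | rfl | rfl)
      · exact h.1
      · exact ha
      · exact haz
  rw [h, card_union_of_disjoint, card_pair]
  · simpa using hz1
  · rw [disjoint_left]
    intro x hx
    simp only [mem_filter, mem_univ, true_and, hQ] at hx
    simp [hx.2.1, hx.2.2]

open Classical in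
/-- Two sets of rungs that cover all rungs, meet at most once in each coset of `K`, and have
prescribed sizes modulo 4 in each coset of `H` and of `K`, respectively. -/
theorem exists_rung_cover {G : Type*} [Group G] [Fintype G] (H K : Subgroup G)
    {z u v : G} (hz2 : z * z = 1) (hz1 : z ≠ 1) (hzH : z ∈ H) (hzK : z ∈ K) (hu : u ∈ H)
    (hv : v ∈ K) (hu1 : u ≠ 1) (huz : u ≠ z) (hv1 : v ≠ 1) (hvz : v ≠ z) (t t' : ℕ)
    (ht : t = 0 ∨ t = 2) (ht' : t' = 0 ∨ t' = 2) :
    ∃ (R R' : G → Prop) (b : G ⧸ K → G), (∀ x, R (x * z) ↔ R x) ∧ (∀ x, R' (x * z) ↔ R' x) ∧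
      (∀ c : G ⧸ H, Nat.card {x : G // (x : G ⧸ H) = c ∧ R x} % 4 = t) ∧
      (∀ c : G ⧸ K, Nat.card {x : G // (x : G ⧸ K) = c ∧ R' x} % 4 = t') ∧
      (∀ x, R x ∨ R' x) ∧ ∀ x, R x → R' x → x = b x ∨ x = b x * z := by
  obtain ⟨a, b, ha, hb, hab⟩ :=
    exists_disjoint_rung_systems H K hz2 hzH hzK hu hv hu1 huz hv1 hvz
  have hmkH : ∀ x : G, ((x * z : G) : G ⧸ H) = x := fun x => QuotientGroup.mk_mul_of_mem _ hzH
  have hmkK : ∀ x : G, ((x * z : G) : G ⧸ K) = x := fun x => QuotientGroup.mk_mul_of_mem _ hzK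
  have hmul : ∀ x y : G, x * z = y ↔ x = y * z := by
    intro x y
    constructor <;> rintro rfl <;> simp [mul_assoc, hz2]
  have hmul' : ∀ x y : G, (x * z = y ∨ x * z = y * z) ↔ (x = y ∨ x = y * z) := by
    intro x y
    rw [hmul, mul_left_inj, or_comm]
  let N : G ⧸ H → ℕ := fun c => Nat.card {x : G // (x : G ⧸ H) = c}
  let R : G → Prop := fun x => ¬ (N x % 4 ≠ t ∧ (x = a x ∨ x = a x * z))
  have hR : ∀ x, R (x * z) ↔ R x := by
    intro x
    simp only [R, hmkH, hmul']
  let N' : G ⧸ K → ℕ := fun d => Nat.card {x : G // (x : G ⧸ K) = d ∧ ¬ R x}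
  let R' : G → Prop := fun x => ¬ R x ∨ (N' x % 4 ≠ t' ∧ (x = b x ∨ x = b x * z))
  have hR' : ∀ x, R' (x * z) ↔ R' x := by
    intro x
    simp only [R', hmkK, hmul', hR]
  have hbR : ∀ d, R (b d) := fun d h => h.2.elim (hab _ _).1 (hab _ _).2
  refine ⟨R, R', b, hR, hR', fun c => ?_, fun d => ?_, fun x => ?_, fun x h h' => ?_⟩
  · have hN : N c % 2 = 0 := by
      exact natCard_mod_two_of_involution hz2 hz1 (fun x : G => (x : G ⧸ H) = c)
        (fun x => by rw [hmkH])
    by_cases h : N c % 4 = t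
    · rw [← h]
      congr 1
      refine Nat.card_congr (Equiv.subtypeEquivRight fun x => ⟨And.left, ?_⟩)
      rintro rfl
      exact ⟨rfl, fun h' => h'.1 h⟩
    · have hc : N c = Nat.card {x : G // (x : G ⧸ H) = c ∧ R x} + 2 := by
        refine natCard_eq_add_two (a := a c) hz1 (fun x : G => (x : G ⧸ H) = c) _ (ha c)
          ((hmkH _).trans (ha c)) ?_
        intro x
        refine and_congr_right ?_
        rintro rfl
        simp only [R, h, ne_eq, not_false_eq_true, true_and, not_or]
      omega
  · have hN : N' d % 2 = 0 := by
      exact natCard_mod_two_of_involution hz2 hz1 (fun x : G => (x : G ⧸ K) = d ∧ ¬ R x)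
        (fun x => by rw [hmkK, hR])
    by_cases h : N' d % 4 = t'
    · rw [← h]
      congr 1
      refine Nat.card_congr (Equiv.subtypeEquivRight fun x => and_congr_right ?_)
      rintro rfl
      simp [R', h]
    · have hc : Nat.card {x : G // (x : G ⧸ K) = d ∧ R' x} = N' d + 2 := by
        refine natCard_eq_add_two (a := b d) hz1 (fun x : G => (x : G ⧸ K) = d ∧ R' x)
          _ ⟨hb d, ?_⟩ ⟨(hmkK _).trans (hb d), ?_⟩ ?_
        · exact Or.inr ⟨by rwa [hb], Or.inl (by rw [hb])⟩
        · rw [hR']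
          exact Or.inr ⟨by rwa [hb], Or.inl (by rw [hb])⟩
        · intro x
          rw [and_assoc]
          refine and_congr_right ?_
          rintro rfl
          have h₁ : x = b x → R x := fun e => by rw [e]; exact hbR _
          have h₂ : x = b x * z → R x := fun e => by rw [e, hR]; exact hbR _
          exact ⟨fun hx => ⟨Or.inl hx, fun e => hx (h₁ e), fun e => hx (h₂ e)⟩,
            fun hx => hx.1.resolve_right fun e => e.2.elim hx.2.1 hx.2.2⟩
      omega
  · exact (Classical.em (R x)).imp_right Or.inl
  · exact (h'.resolve_left (not_not.2 h)).2

open Finset Classical in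
/-- A permutation whose steps have no repetition supports a unit flow along its orbits. -/
theorem exists_unit_flow_of_perm {V : Type*} [Fintype V] (σ : Equiv.Perm V)
    (hσ : ∀ x, σ (σ x) ≠ x) :
    ∃ f : V → V → ℤ, (∀ x y, f x y = - f y x) ∧ (∀ x, ∑ y, f x y = 0) ∧
      (∀ x y, (y = σ x ∨ x = σ y) → |f x y| = 1) ∧
      (∀ x y, ¬ (y = σ x ∨ x = σ y) → f x y = 0) := by
  refine ⟨fun x y => (if y = σ x then 1 else 0) - (if x = σ y then 1 else 0),
    fun x y => by ring, fun x => ?_, fun x y h => ?_, fun x y h => ?_⟩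
  · have h : ∀ y, x = σ y ↔ y = σ.symm x := fun y => by rw [Equiv.eq_symm_apply, eq_comm]
    simp [sum_sub_distrib, h]
  · rcases h with rfl | rfl
    · simp [(hσ x).symm]
    · simp [(hσ y).symm]
  · rw [not_or] at h
    simp [h.1, h.2]

/-- Distinct `y` and `y'` with `{y, y'}` inverse-closed: the 2-regular Cayley graph they
generate consists of the orbits of a permutation. -/
theorem exists_perm_of_pair {G : Type*} [Group G] [Finite G] (y y' : G) (hne : y ≠ y')
    (h1 : y ≠ 1) (h1' : y' ≠ 1) (h : y' = y⁻¹ ∨ (y * y = 1 ∧ y' * y' = 1)) :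
    ∃ σ : Equiv.Perm G, (∀ x, σ (σ x) ≠ x) ∧
      ∀ a b, (a⁻¹ * b = y ∨ a⁻¹ * b = y') ↔ (b = σ a ∨ a = σ b) := by
  rcases h with rfl | ⟨hy, hy'⟩
  · refine ⟨Equiv.mulRight y, fun x h => hne ?_, fun a b => or_congr ?_ ?_⟩
    · simp only [Equiv.coe_mulRight, mul_assoc, mul_eq_left] at h
      exact eq_inv_of_mul_eq_one_left h
    · rw [inv_mul_eq_iff_eq_mul]; rfl
    · rw [inv_mul_eq_iff_eq_mul, eq_mul_inv_iff_mul_eq, eq_comm]; rfl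
  · have hyi : y⁻¹ = y := inv_eq_of_mul_eq_one_left hy
    have hyi' : y'⁻¹ = y' := inv_eq_of_mul_eq_one_left hy'
    set H := Subgroup.zpowers (y * y') with hH
    obtain ⟨n, ⟨e⟩⟩ := Finite.exists_equiv_fin (G ⧸ H)
    have hmem : y * y' ∈ H := Subgroup.mem_zpowers _
    have hmem' : y' * y ∈ H := by
      have := H.inv_mem hmem
      rwa [mul_inv_rev, hyi, hyi'] at this
    have hnot : y ∉ H := by
      intro hyH
      have hc : y * (y * y') = (y * y') * y := by
        obtain ⟨k, hk⟩ := Subgroup.mem_zpowers_iff.1 hyH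
        conv_lhs => lhs; rw [← hk]
        conv_rhs => rhs; rw [← hk]
        exact ((Commute.refl (y * y')).zpow_left k)
      have hc' : y * y' = y' * y := by
        rw [mul_assoc] at hc
        exact mul_left_cancel hc
      have hsq : (y * y') * (y * y') = 1 := by
        calc (y * y') * (y * y') = (y * y') * (y' * y) := by rw [← hc']
          _ = 1 := by rw [mul_assoc, ← mul_assoc y', hy', one_mul, hy]
      obtain ⟨k, hk⟩ := Subgroup.mem_zpowers_iff.1 hyH
      rcases Int.even_or_odd' k with ⟨m, rfl | rfl⟩
      · rw [zpow_mul, zpow_ofNat, pow_two, hsq, one_zpow] at hk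
        exact h1 hk.symm
      · rw [zpow_add, zpow_mul, zpow_ofNat, pow_two, hsq, one_zpow, one_mul, zpow_one]
          at hk
        exact h1' (mul_eq_left.1 hk)
    let χ : G → Prop := fun g => e (g : G ⧸ H) < e ((g * y : G) : G ⧸ H)
    have hχy : ∀ g, χ (g * y) ↔ ¬ χ g := by
      intro g
      have hn : e (g : G ⧸ H) ≠ e ((g * y : G) : G ⧸ H) := by
        rw [Ne, e.injective.eq_iff, QuotientGroup.eq]
        simpa using hnot
      simp only [χ, mul_assoc, hy, mul_one, not_lt]
      exact ⟨le_of_lt, fun h => lt_of_le_of_ne h hn.symm⟩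
    have hχy' : ∀ g, χ (g * y') ↔ ¬ χ g := by
      intro g
      rw [← hχy]
      have h₁ : ((g * y' : G) : G ⧸ H) = (g * y : G) := by
        rw [QuotientGroup.eq, mul_inv_rev, hyi', mul_assoc, inv_mul_cancel_left]
        exact hmem'
      have h₂ : ((g * y' * y : G) : G ⧸ H) = (g * y * y : G) := by
        rw [mul_assoc, mul_assoc, hy, mul_one]
        exact QuotientGroup.mk_mul_of_mem _ hmem'
      simp only [χ, h₁, h₂]
    classical
    let s : G → G := fun g => if χ g then g * y else g * y'
    let s' : G → G := fun g => if χ g then g * y' else g * y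
    have hs' : ∀ g, s' (s g) = g := by
      intro g
      by_cases h : χ g
      · simp [s, s', h, hχy, mul_assoc, hy]
      · simp [s, s', h, hχy', mul_assoc, hy']
    have hs : ∀ g, s (s' g) = g := by
      intro g
      by_cases h : χ g
      · simp [s, s', h, hχy', mul_assoc, hy']
      · simp [s, s', h, hχy, mul_assoc, hy]
    refine ⟨⟨s, s', hs', hs⟩, fun x h => ?_, fun a b => ?_⟩
    · have : s x = s' x := by
        rw [← hs' (s x)]
        exact congrArg s' h
      by_cases hx : χ x
      · exact hne (by simpa [s, s', hx] using this)
      · exact hne (by simpa [s, s', hx] using this.symm)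
    · have hb : (a = s b) ↔ (b = s' a) := by
        constructor
        · rintro rfl; exact (hs' b).symm
        · rintro rfl; exact (hs a).symm
      rw [inv_mul_eq_iff_eq_mul, inv_mul_eq_iff_eq_mul]
      change _ ↔ (b = s a ∨ a = s b)
      rw [hb]
      by_cases hx : χ a
      · simp [s, s', hx]
      · simp [s, s', hx, or_comm]

/-- A Cayley graph of even valency has a flow with values `±1`. -/
theorem exists_unit_flow_of_even {G : Type*} [Group G] [Fintype G] (Y : Finset G)
    (h1 : (1 : G) ∉ Y) (hinv : ∀ x ∈ Y, x⁻¹ ∈ Y) (hY : Even Y.card) :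
    ∃ f : G → G → ℤ, (∀ x y, f x y = - f y x) ∧ (∀ x, ∑ y, f x y = 0) ∧
      (∀ x y, x⁻¹ * y ∈ Y → |f x y| = 1) ∧ (∀ x y, x⁻¹ * y ∉ Y → f x y = 0) := by
  classical
  induction hn : Y.card using Nat.strong_induction_on generalizing Y with
  | _ n ih =>
  rcases Y.eq_empty_or_nonempty with rfl | hne
  · exact ⟨fun _ _ => 0, by simp, by simp, by simp, by simp⟩
  have : ∃ y ∈ Y, ∃ y' ∈ Y, y ≠ y' ∧ (y' = y⁻¹ ∨ (y * y = 1 ∧ y' * y' = 1)) := by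
    by_cases h : ∃ y ∈ Y, y ≠ y⁻¹
    · obtain ⟨y, hy, hyne⟩ := h
      exact ⟨y, hy, y⁻¹, hinv y hy, hyne, Or.inl rfl⟩
    · push Not at h
      have hc : 1 < Y.card := by
        have := hne.card_pos
        rcases hY with ⟨k, hk⟩
        omega
      obtain ⟨y, hy, y', hy', hyne⟩ := Finset.one_lt_card.1 hc
      refine ⟨y, hy, y', hy', hyne, Or.inr ⟨?_, ?_⟩⟩
      · exact mul_eq_one_iff_eq_inv.2 (h y hy)
      · exact mul_eq_one_iff_eq_inv.2 (h y' hy')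
  obtain ⟨y, hy, y', hy', hyne, hpair⟩ := this
  have hyinv : y⁻¹ = y ∨ y⁻¹ = y' := by
    rcases hpair with h | h
    · exact Or.inr h.symm
    · exact Or.inl (inv_eq_of_mul_eq_one_left h.1)
  have hyinv' : y'⁻¹ = y ∨ y'⁻¹ = y' := by
    rcases hpair with h | h
    · exact Or.inl (by rw [h, inv_inv])
    · exact Or.inr (inv_eq_of_mul_eq_one_left h.2)
  obtain ⟨σ, hσ, hσY⟩ := exists_perm_of_pair y y' hyne (fun h => h1 (h ▸ hy))
    (fun h => h1 (h ▸ hy')) hpair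
  obtain ⟨f, hf₁, hf₂, hf₃, hf₄⟩ := exists_unit_flow_of_perm σ hσ
  have hcard : (Y \ {y, y'}).card + 2 = Y.card := by
    rw [← Finset.card_pair hyne]
    exact Finset.card_sdiff_add_card_eq_card (by simp [Finset.insert_subset_iff, hy, hy'])
  have hmem : ∀ x, x ∈ Y ↔ x ∈ Y \ {y, y'} ∨ (x = y ∨ x = y') := by
    intro x
    simp only [Finset.mem_sdiff, Finset.mem_insert, Finset.mem_singleton]
    constructor
    · tauto
    · rintro (h | rfl | rfl)
      · exact h.1
      · exact hy
      · exact hy'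
  have hdis : ∀ x, x ∈ Y \ {y, y'} → ¬ (x = y ∨ x = y') := by
    intro x hx
    simpa using (Finset.mem_sdiff.1 hx).2
  obtain ⟨g, hg₁, hg₂, hg₃, hg₄⟩ := ih _ (by omega) (Y \ {y, y'})
    (fun h => h1 (Finset.mem_sdiff.1 h).1)
    (fun x hx => by
      simp only [Finset.mem_sdiff, Finset.mem_insert, Finset.mem_singleton] at hx ⊢
      refine ⟨hinv x hx.1, fun h => hx.2 ?_⟩
      rcases h with h | h
      · rw [← inv_inv x, h]; exact hyinv
      · rw [← inv_inv x, h]; exact hyinv')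
    (by rw [← hcard] at hY; exact (Nat.even_add.1 hY).2 even_two) rfl
  refine ⟨fun a b => f a b + g a b, fun a b => ?_, fun a => ?_, fun a b h => ?_, fun a b h => ?_⟩
  · simp only [hf₁ a b, hg₁ a b]; ring
  · simp only [Finset.sum_add_distrib, hf₂, hg₂, add_zero]
  · rcases (hmem _).1 h with h | h
    · simp only [hf₄ a b (by rw [← hσY]; exact hdis _ h), zero_add, hg₃ a b h]
    · simp only [hf₃ a b ((hσY a b).1 h), hg₄ a b (fun h' => hdis _ h' h), add_zero]
  · rw [hmem, not_or] at h
    simp only [hf₄ a b (by rw [← hσY]; exact h.2), hg₄ a b h.1, add_zero]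

open Finset Classical in
/-- The flow on a union of ladders determined by a two-valued rail labelling. -/
theorem exists_ladder_flow {G : Type*} [Group G] [Fintype G] {z : G} (hz2 : z * z = 1)
    (σ : Equiv.Perm G) (hσz : ∀ x, σ (x * z) = σ x * z) (hσ2 : ∀ x, σ (σ x) ≠ x)
    (hσne : ∀ x, σ x ≠ x * z) (R : G → Prop) (s : G → ZMod 2) (hs : ∀ x, s (x * z) = s x + 1)
    (hR : ∀ x, (R (σ x) → s (σ x) = s x + 1) ∧ (¬ R (σ x) → s (σ x) = s x)) (α β : ℤ) :
    ∃ f : G → G → ℤ, (∀ x y, f x y = - f y x) ∧ (∀ x, ∑ y, f x y = 0) ∧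
      (∀ x y, (y = σ x ∨ x = σ y) → |f x y| = |α| ∨ |f x y| = |β|) ∧
      (∀ x, R x → s x = 0 → f x (x * z) = β - α) ∧
      (∀ x, R x → s x = 1 → f x (x * z) = α - β) ∧
      (∀ x, ¬ R x → f x (x * z) = 0) ∧
      ∀ x y, ¬ (y = σ x ∨ x = σ y) → y ≠ x * z → f x y = 0 := by
  let a : G → ℤ := fun x => if s x = 0 then α else β
  have haz : ∀ x, a (x * z) = α + β - a x := by
    intro x
    have two : (1 : ZMod 2) + 1 = 0 := by decide
    rcases ZMod.two_eq_zero_or_one (s x) with h | h <;> simp [a, hs, h, two]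
  have ha : ∀ x, a x = α ∨ a x = β := by
    intro x
    by_cases h : s x = 0 <;> simp [a, h]
  have hsymm : ∀ x y, x = y * z ↔ y = x * z := by
    intro x y
    constructor <;> rintro rfl <;> simp [mul_assoc, hz2]
  have hσz' : ∀ x, σ.symm (x * z) = σ.symm x * z := fun x => by
    rw [Equiv.symm_apply_eq, hσz, Equiv.apply_symm_apply]
  have hσne' : ∀ x, x ≠ σ (x * z) := by
    intro x h
    rw [hσz, hsymm] at h
    exact hσne x h
  let r : G → ℤ := fun x => a (σ.symm x) - a x
  let f : G → G → ℤ := fun x y => (if y = σ x then a x else 0) - (if x = σ y then a y else 0) +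
    (if y = x * z then r x else 0)
  have hfr : ∀ x, f x (x * z) = r x := by
    intro x
    simp only [f]
    rw [if_neg (hσne x).symm, if_neg (hσne' x)]
    simp
  refine ⟨f, ?_, ?_, ?_, ?_, ?_, ?_, ?_⟩
  · intro x y
    have h : (if y = x * z then r x else 0) = -(if x = y * z then r y else 0) := by
      by_cases h : y = x * z
      · rw [if_pos h, if_pos ((hsymm x y).2 h), h]
        simp only [r, hσz', haz]
        ring
      · rw [if_neg h, if_neg (fun h' => h ((hsymm x y).1 h')), neg_zero]
    simp only [f, h]
    ring
  · intro x
    have h : ∀ y, x = σ y ↔ y = σ.symm x := fun y => by rw [Equiv.eq_symm_apply, eq_comm]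
    simp [f, r, h, sum_add_distrib, sum_sub_distrib]
  · intro x y h
    rcases h with rfl | rfl
    · have : f x (σ x) = a x := by
        simp [f, hσne, (hσ2 x).symm]
      rw [this]
      rcases ha x with h | h <;> simp [h]
    · have hne : y ≠ σ y * z := fun h => hσne y ((hsymm _ _).2 h)
      have : f (σ y) y = - a y := by
        simp [f, hne, (hσ2 y).symm]
      rw [this, abs_neg]
      rcases ha y with h | h <;> simp [h]
  · intro x hx h
    obtain ⟨y, rfl⟩ := σ.surjective x
    have h' : s y = 1 := by
      have := (hR y).1 hx
      rw [h] at this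
      revert this
      generalize s y = c
      revert c
      decide
    simp [hfr, r, a, h, h']
  · intro x hx h
    obtain ⟨y, rfl⟩ := σ.surjective x
    have h' : s y = 0 := by
      have := (hR y).1 hx
      rw [h] at this
      revert this
      generalize s y = c
      revert c
      decide
    simp [hfr, r, a, h, h']
  · intro x hx
    obtain ⟨y, rfl⟩ := σ.surjective x
    simp [hfr, r, a, (hR y).2 hx]
  · intro x y h hz
    rw [not_or] at h
    simp [f, h.1, h.2, hz]

open Finset in
/-- Two closed ladders on a common rung involution and disjoint rails. -/
theorem exists_flow_of_two_ladders {G : Type*} [Group G] [Fintype G] (H K : Subgroup G)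
    {z u₁ u₂ v₁ v₂ : G} (hz2 : z * z = 1) (hz1 : z ≠ 1)
    (hzH : z ∈ H) (hu₁ : u₁ ∈ H) (hu₂ : u₂ ∈ H) (hzK : z ∈ K) (hv₁ : v₁ ∈ K) (hv₂ : v₂ ∈ K)
    (hu₁1 : u₁ ≠ 1) (hu₂1 : u₂ ≠ 1) (hv₁1 : v₁ ≠ 1) (hv₂1 : v₂ ≠ 1)
    (hu₁z : u₁ ≠ z) (hu₂z : u₂ ≠ z) (hv₁z : v₁ ≠ z) (hv₂z : v₂ ≠ z)
    (huv₁₁ : u₁ ≠ v₁) (huv₁₂ : u₁ ≠ v₂) (huv₂₁ : u₂ ≠ v₁) (huv₂₂ : u₂ ≠ v₂)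
    (hu₁inv : u₁⁻¹ = u₁ ∨ u₁⁻¹ = u₂) (hu₂inv : u₂⁻¹ = u₁ ∨ u₂⁻¹ = u₂)
    (hv₁inv : v₁⁻¹ = v₁ ∨ v₁⁻¹ = v₂) (hv₂inv : v₂⁻¹ = v₁ ∨ v₂⁻¹ = v₂)
    (hU : IsClosedLadderWithRungInvolution
      ((fun x : H => (x : G)) ⁻¹' ({u₁, u₂, z} : Set G)) ⟨z, hzH⟩)
    (hV : IsClosedLadderWithRungInvolution
      ((fun x : K => (x : G)) ⁻¹' ({v₁, v₂, z} : Set G)) ⟨z, hzK⟩) :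
    ∃ f : G → G → ℤ, (∀ x y, f x y = - f y x) ∧ (∀ x, ∑ y, f x y = 0) ∧
      ∀ x y, (x⁻¹ * y ∈ ({u₁, u₂, v₁, v₂, z} : Set G) → |f x y| = 1 ∨ |f x y| = 2) ∧
        (x⁻¹ * y ∉ ({u₁, u₂, v₁, v₂, z} : Set G) → f x y = 0) := by
  have hzinv : z⁻¹ = z := inv_eq_of_mul_eq_one_left hz2
  obtain ⟨σ, t, ht, hσz, hσ, hσ2, hs⟩ := exists_perm_of_isClosedLadder H hu₁ hu₂ hzH hu₁1 hu₂1
    hz1 hu₁z hu₂z hu₁inv hu₂inv hzinv hU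
  obtain ⟨ρ, t', ht', hρz, hρ, hρ2, hs'⟩ := exists_perm_of_isClosedLadder K hv₁ hv₂ hzK hv₁1 hv₂1
    hz1 hv₁z hv₂z hv₁inv hv₂inv hzinv hV
  obtain ⟨R, R', b, hR, hR', hcard, hcard', hcover, hb⟩ := exists_rung_cover H K hz2 hz1 hzH hzK
    hu₁ hv₁ hu₁1 hu₁z hv₁1 hv₁z t t' ht ht'
  obtain ⟨s, hsz, hsR⟩ := hs R hR hcard
  obtain ⟨s₀, hs₀z, hs₀R⟩ := hs' R' hR' hcard'
  have hstep : ∀ x, ((ρ x : G) : G ⧸ K) = x := by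
    intro x
    refine (QuotientGroup.eq.2 ?_).symm
    rcases (hρ x (ρ x)).2 (Or.inl rfl) with h | h <;> rw [h] <;> assumption
  have hmkz : ∀ x : G, ((x * z : G) : G ⧸ K) = x := fun x => QuotientGroup.mk_mul_of_mem _ hzK
  obtain ⟨s', hs'z, hs'R, hss'⟩ : ∃ s' : G → ZMod 2, (∀ x, s' (x * z) = s' x + 1) ∧
      (∀ x, (R' (ρ x) → s' (ρ x) = s' x + 1) ∧ (¬ R' (ρ x) → s' (ρ x) = s' x)) ∧
      ∀ x, R x → R' x → s' x = s x := by
    have two : ∀ c : ZMod 2, c + c = 0 := by decide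
    refine ⟨fun x => s₀ x + (s₀ (b x) + s (b x)), fun x => ?_, fun x => ⟨fun h => ?_, fun h => ?_⟩,
      fun x h h' => ?_⟩
    · simp only [hmkz, hs₀z]; ring
    · simp only [hstep, (hs₀R x).1 h]; ring
    · simp only [hstep, (hs₀R x).2 h]
    · have key : s₀ x + s₀ (b x) = s x + s (b x) := by
        rcases hb x h h' with e | e
        · rw [← e, two, two]
        · have e₀ : s₀ x = s₀ (b x) + 1 := by rw [← hs₀z, ← e]
          have e₁ : s x = s (b x) + 1 := by rw [← hsz, ← e]
          rw [e₀, e₁, add_right_comm, two, add_right_comm, two]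
      simp only [← add_assoc, key]
      rw [add_assoc, two, add_zero]
  have hσne : ∀ x, σ x ≠ x * z := by
    intro x h
    have := (hσ x (σ x)).2 (Or.inl rfl)
    rw [h, inv_mul_cancel_left] at this
    rcases this with h | h
    · exact hu₁z h.symm
    · exact hu₂z h.symm
  have hρne : ∀ x, ρ x ≠ x * z := by
    intro x h
    have := (hρ x (ρ x)).2 (Or.inl rfl)
    rw [h, inv_mul_cancel_left] at this
    rcases this with h | h
    · exact hv₁z h.symm
    · exact hv₂z h.symm
  obtain ⟨f, hf, hf0, hfrail, hfr₀, hfr₁, hfn, hfz⟩ :=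
    exists_ladder_flow hz2 σ hσz hσ2 hσne R s hsz hsR 1 (-1)
  obtain ⟨g, hg, hg0, hgrail, hgr₀, hgr₁, hgn, hgz⟩ :=
    exists_ladder_flow hz2 ρ hρz hρ2 hρne R' s' hs'z hs'R 1 2
  refine ⟨fun x y => f x y + g x y, fun x y => ?_, fun x => ?_, fun x y => ⟨fun h => ?_, fun h => ?_⟩⟩
  · simp only [hf x y, hg x y]; ring
  · simp only [sum_add_distrib, hf0, hg0, add_zero]
  · have h' : (x⁻¹ * y = u₁ ∨ x⁻¹ * y = u₂) ∨ (x⁻¹ * y = v₁ ∨ x⁻¹ * y = v₂) ∨ x⁻¹ * y = z := by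
      simp only [Set.mem_insert_iff, Set.mem_singleton_iff] at h
      rcases h with h | h | h | h | h
      exacts [.inl (.inl h), .inl (.inr h), .inr (.inl (.inl h)), .inr (.inl (.inr h)),
        .inr (.inr h)]
    rcases h' with h | h | h
    · have hg' : g x y = 0 := by
        refine hgz x y ?_ ?_
        · rw [← hρ]
          rcases h with h | h <;> rw [h] <;> simp [huv₁₁, huv₁₂, huv₂₁, huv₂₂]
        · rw [Ne, ← inv_mul_eq_iff_eq_mul]
          rcases h with h | h <;> rw [h] <;> assumption
      simp only [hg', add_zero]
      left
      simpa using hfrail x y ((hσ x y).1 h)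
    · have hf' : f x y = 0 := by
        refine hfz x y ?_ ?_
        · rw [← hσ]
          rcases h with h | h <;> rw [h] <;> simp [huv₁₁.symm, huv₁₂.symm, huv₂₁.symm, huv₂₂.symm]
        · rw [Ne, ← inv_mul_eq_iff_eq_mul]
          rcases h with h | h <;> rw [h] <;> assumption
      simp only [hf', zero_add]
      simpa using hgrail x y ((hρ x y).1 h)
    · rw [inv_mul_eq_iff_eq_mul] at h
      subst h
      by_cases hx : R x
      · by_cases hx' : R' x
        · have e := hss' x hx hx'
          rcases ZMod.two_eq_zero_or_one (s x) with hs | hs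
          · simp only [hfr₀ x hx hs, hgr₀ x hx' (e.trans hs)]; norm_num
          · simp only [hfr₁ x hx hs, hgr₁ x hx' (e.trans hs)]; norm_num
        · rcases ZMod.two_eq_zero_or_one (s x) with hs | hs
          · simp only [hfr₀ x hx hs, hgn x hx']; norm_num
          · simp only [hfr₁ x hx hs, hgn x hx']; norm_num
      · have hx' := (hcover x).resolve_left hx
        rcases ZMod.two_eq_zero_or_one (s' x) with hs | hs
        · simp only [hfn x hx, hgr₀ x hx' hs]; norm_num
        · simp only [hfn x hx, hgr₁ x hx' hs]; norm_num
  · simp only [Set.mem_insert_iff, Set.mem_singleton_iff, not_or] at h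
    obtain ⟨h₁, h₂, h₃, h₄, h₅⟩ := h
    have h₅' : y ≠ x * z := by rwa [Ne, ← inv_mul_eq_iff_eq_mul]
    simp only [hfz x y (by rw [← hσ]; simp [h₁, h₂]) h₅', hgz x y (by rw [← hρ]; simp [h₃, h₄]) h₅',
      add_zero]

/-- Let `X` be an inverse-closed connection set of size at least 5 in a finite group `G`,
containing an involution `z` and four further pairwise distinct elements `u₁, u₂, v₁, v₂`
such that `{u₁, u₂}` and `{v₁, v₂}` are inverse-closed and the cubic Cayley graphs
`Cay(⟨u₁,u₂,z⟩, {u₁,u₂,z})` and `Cay(⟨v₁,v₂,z⟩, {v₁,v₂,z})` are closed ladders with `z`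
as their rung involution.  Then `Cay(G, X)` admits a nowhere-zero 3-flow. -/
theorem cayley_two_closed_ladders_nowhere_zero_3_flow
    {G : Type*} [Group G] [Fintype G] [DecidableEq G]
    (X : Finset G) (h1 : (1 : G) ∉ X) (hinv : ∀ x ∈ X, x⁻¹ ∈ X) (hcard : 5 ≤ X.card)
    (z u₁ u₂ v₁ v₂ : G)
    (hzX : z ∈ X) (hu₁ : u₁ ∈ X) (hu₂ : u₂ ∈ X) (hv₁ : v₁ ∈ X) (hv₂ : v₂ ∈ X)
    (hdist : ({u₁, u₂, v₁, v₂, z} : Finset G).card = 5)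
    (hz : orderOf z = 2)
    (hu₁inv : u₁⁻¹ ∈ ({u₁, u₂} : Set G)) (hu₂inv : u₂⁻¹ ∈ ({u₁, u₂} : Set G))
    (hv₁inv : v₁⁻¹ ∈ ({v₁, v₂} : Set G)) (hv₂inv : v₂⁻¹ ∈ ({v₁, v₂} : Set G))
    (hU : IsClosedLadderWithRungInvolution
      ((fun x : ↥(Subgroup.closure ({u₁, u₂, z} : Set G)) => (x : G)) ⁻¹'
        ({u₁, u₂, z} : Set G))
      ⟨z, Subgroup.subset_closure (by simp)⟩)
    (hV : IsClosedLadderWithRungInvolution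
      ((fun x : ↥(Subgroup.closure ({v₁, v₂, z} : Set G)) => (x : G)) ⁻¹'
        ({v₁, v₂, z} : Set G))
      ⟨z, Subgroup.subset_closure (by simp)⟩) :
    HasNowhereZero3Flow (cayleyGraph (X : Set G)) := by
  have hadj := cayleyGraph_adj (X := (X : Set G)) (by simpa using h1) (by simpa using hinv)
  rcases Nat.even_or_odd X.card with heven | hodd
  · obtain ⟨f, hf, hf0, hf1, hfz⟩ := exists_unit_flow_of_even X h1 hinv heven
    refine ⟨f, hf, fun x y h => hfz x y ?_, fun x y h => ?_, hf0⟩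
    · rwa [hadj] at h
    · rw [hadj] at h
      rw [hf1 x y h]
      norm_num
  have n₁ : u₁ ∉ ({u₂, v₁, v₂, z} : Finset G) := by
    intro h
    rw [Finset.insert_eq_of_mem h] at hdist
    have := Finset.card_le_four (a := u₂) (b := v₁) (c := v₂) (d := z)
    omega
  have hdist₁ := hdist
  rw [Finset.card_insert_of_notMem n₁] at hdist₁
  have n₂ : u₂ ∉ ({v₁, v₂, z} : Finset G) := by
    intro h
    rw [Finset.insert_eq_of_mem h] at hdist₁
    have := Finset.card_le_three (a := v₁) (b := v₂) (c := z)
    omega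
  rw [Finset.card_insert_of_notMem n₂] at hdist₁
  have n₃ : v₁ ∉ ({v₂, z} : Finset G) := by
    intro h
    rw [Finset.insert_eq_of_mem h] at hdist₁
    have := Finset.card_le_two (a := v₂) (b := z)
    omega
  rw [Finset.card_insert_of_notMem n₃] at hdist₁
  have n₄ : v₂ ≠ z := by
    rintro rfl
    simp at hdist₁
  simp only [Finset.mem_insert, Finset.mem_singleton, not_or] at n₁ n₂ n₃
  have ne_one : ∀ x ∈ X, x ≠ 1 := fun x hx h => h1 (h ▸ hx)
  have hz2 : z * z = 1 := by rw [← pow_two, ← hz, pow_orderOf_eq_one]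
  have hzinv : z⁻¹ = z := inv_eq_of_mul_eq_one_left hz2
  simp only [Set.mem_insert_iff, Set.mem_singleton_iff] at hu₁inv hu₂inv hv₁inv hv₂inv
  obtain ⟨f, hf, hf0, hfX⟩ := exists_flow_of_two_ladders
    (Subgroup.closure {u₁, u₂, z}) (Subgroup.closure {v₁, v₂, z}) hz2 (ne_one z hzX)
    (Subgroup.subset_closure (by simp)) (Subgroup.subset_closure (by simp))
    (Subgroup.subset_closure (by simp)) (Subgroup.subset_closure (by simp))
    (Subgroup.subset_closure (by simp)) (Subgroup.subset_closure (by simp))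
    (ne_one _ hu₁) (ne_one _ hu₂) (ne_one _ hv₁) (ne_one _ hv₂)
    n₁.2.2.2 n₂.2.2 n₃.2 n₄ n₁.2.1 n₁.2.2.1 n₂.1 n₂.2.1 hu₁inv hu₂inv hv₁inv hv₂inv hU hV
  set L : Finset G := {u₁, u₂, v₁, v₂, z} with hL
  have hLX : L ⊆ X := by simp [L, Finset.insert_subset_iff, *]
  have hLinv : ∀ x, x⁻¹ ∈ L → x ∈ L := by
    intro x hx
    have hall : ∀ y ∈ L, y⁻¹ ∈ L := by
      simp only [hL, Finset.mem_insert, Finset.mem_singleton]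
      rintro y (h | h | h | h | h) <;> rw [h]
      · rcases hu₁inv with h | h <;> simp [h]
      · rcases hu₂inv with h | h <;> simp [h]
      · rcases hv₁inv with h | h <;> simp [h]
      · rcases hv₂inv with h | h <;> simp [h]
      · simp [hzinv]
    simpa using hall _ hx
  have hcL := Finset.card_sdiff_add_card_eq_card hLX
  obtain ⟨g, hg, hg0, hg1, hgz⟩ := exists_unit_flow_of_even (X \ L)
    (fun h => h1 (Finset.mem_sdiff.1 h).1)
    (fun x hx => Finset.mem_sdiff.2 ⟨hinv x (Finset.mem_sdiff.1 hx).1,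
      fun h => (Finset.mem_sdiff.1 hx).2 (hLinv x h)⟩)
    (by
      rw [hdist] at hcL
      rcases hodd with ⟨k, hk⟩
      exact ⟨k - 2, by omega⟩)
  have hmem : ∀ x : G, x ∈ ({u₁, u₂, v₁, v₂, z} : Set G) ↔ x ∈ L := by simp [hL]
  simp only [hmem] at hfX
  refine ⟨fun x y => f x y + g x y, fun x y => ?_, fun x y h => ?_, fun x y h => ?_, fun x => ?_⟩
  · simp only [hf x y, hg x y]
    ring
  · rw [hadj, Finset.mem_coe] at h
    simp only [(hfX x y).2 (fun h' => h (hLX h')),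
      hgz x y (fun h' => h (Finset.mem_sdiff.1 h').1), add_zero]
  · rw [hadj, Finset.mem_coe] at h
    by_cases h' : x⁻¹ * y ∈ L
    · simp only [hgz x y (fun h'' => (Finset.mem_sdiff.1 h'').2 h'), add_zero]
      rcases (hfX x y).1 h' with e | e <;> rw [e] <;> norm_num
    · simp only [(hfX x y).2 h', hg1 x y (Finset.mem_sdiff.2 ⟨h, h'⟩), zero_add]
      norm_num
  · simp only [Finset.sum_add_distrib, hf0, hg0, add_zero]
end
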